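/- For every real ε > 0 there exists k₀ such that for every integer k ≥ k₀ the following holds: every graph G on n ≥ (2+ε)k² vertices with independence number at most k contains a cycle of length ℓ for every integer ℓ with 3 ≤ ℓ ≤ (2+ε)k. -/

import Mathlib

open SimpleGraph Finset

/-- `G` contains a cycle of length `ℓ`. -/
def HasCycleLength {V : Type} (G : SimpleGraph V) (ℓ : ℕ) : Prop :=
  ∃ (v : V) (c : G.Walk v v), c.IsCycle ∧ c.length = ℓ

/-- `G` is Hamiltonian: it contains a cycle passing through all vertices. -/
def IsHamiltonianGraph {V : Type} (G : SimpleGraph V) : Prop :=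
  ∃ (v : V) (c : G.Walk v v), c.IsCycle ∧ ∀ u : V, u ∈ c.support

/-- The independence number of `G` is at most `k`. -/
def IndepNumLE {V : Type} (G : SimpleGraph V) (k : ℕ) : Prop :=
  ∀ s : Finset V, (∀ x ∈ s, ∀ y ∈ s, x ≠ y → ¬ G.Adj x y) → s.card ≤ k

/-- `G` is pancyclic: it contains cycles of every length from `3` to `|V(G)|`. -/
def Pancyclic {V : Type} [Fintype V] (G : SimpleGraph V) : Prop :=
  ∀ ℓ : ℕ, 3 ≤ ℓ → ℓ ≤ Fintype.card V → HasCycleLength G ℓ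

namespace CycP

open scoped Classical

def Ind {V : Type} (G : SimpleGraph V) (s : Finset V) : Prop :=
  ∀ x ∈ s, ∀ y ∈ s, x ≠ y → ¬ G.Adj x y

noncomputable def al {V : Type} (G : SimpleGraph V) (U : Finset V) : ℕ :=
  (U.powerset.filter (Ind G)).sup Finset.card

theorem card_le_al {V : Type} {G : SimpleGraph V} {I U : Finset V} (h : I ⊆ U) (hI : Ind G I) :
    I.card ≤ al G U := by
  apply Finset.le_sup (f := Finset.card)
  simp [h, hI]

theorem exists_ind {V : Type} (G : SimpleGraph V) (U : Finset V) :
    ∃ I, I ⊆ U ∧ Ind G I ∧ I.card = al G U := by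
  have hne : (U.powerset.filter (Ind G)).Nonempty := ⟨∅, by simp [Ind]⟩
  obtain ⟨I, hI, h⟩ := Finset.exists_mem_eq_sup _ hne Finset.card
  simp only [mem_filter, mem_powerset] at hI
  exact ⟨I, hI.1, hI.2, h.symm⟩

theorem al_mono {V : Type} {G : SimpleGraph V} {A B : Finset V} (h : A ⊆ B) :
    al G A ≤ al G B := by
  obtain ⟨I, h1, h2, h3⟩ := exists_ind G A
  rw [← h3]
  exact card_le_al (h1.trans h) h2

theorem al_le_card {V : Type} {G : SimpleGraph V} (A : Finset V) :
    al G A ≤ A.card := by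
  obtain ⟨I, h1, h2, h3⟩ := exists_ind G A
  rw [← h3]
  exact card_le_card h1

theorem Ind.subset {V : Type} {G : SimpleGraph V} {A B : Finset V} (h : A ⊆ B) (hB : Ind G B) :
    Ind G A := fun x hx y hy => hB x (h hx) y (h hy)

theorem al_union_le {V : Type} {G : SimpleGraph V} (A B : Finset V) :
    al G (A ∪ B) ≤ al G A + al G B := by
  obtain ⟨I, h1, h2, h3⟩ := exists_ind G (A ∪ B)
  rw [← h3]
  have : I = (I ∩ A) ∪ (I ∩ B) := by
    rw [← Finset.inter_union_distrib_left, Finset.inter_eq_left.2 h1]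
  calc I.card = ((I ∩ A) ∪ (I ∩ B)).card := by rw [← this]
    _ ≤ (I ∩ A).card + (I ∩ B).card := card_union_le _ _
    _ ≤ _ := add_le_add (card_le_al inter_subset_right (h2.subset inter_subset_left))
      (card_le_al inter_subset_right (h2.subset inter_subset_left))

def Sep {V : Type} (G : SimpleGraph V) (A B : Finset V) : Prop :=
  Disjoint A B ∧ ∀ a ∈ A, ∀ b ∈ B, ¬ G.Adj a b

theorem al_union_ge {V : Type} {G : SimpleGraph V} {A B : Finset V} (h : Sep G A B) :
    al G A + al G B ≤ al G (A ∪ B) := by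
  obtain ⟨I, h1, h2, h3⟩ := exists_ind G A
  obtain ⟨J, j1, j2, j3⟩ := exists_ind G B
  have hd : Disjoint I J := disjoint_of_subset_left h1 (disjoint_of_subset_right j1 h.1)
  rw [← h3, ← j3, ← card_union_of_disjoint hd]
  apply card_le_al (union_subset_union h1 j1)
  intro x hx y hy hxy
  rcases mem_union.1 hx with hx | hx <;> rcases mem_union.1 hy with hy | hy
  · exact h2 x hx y hy hxy
  · exact h.2 x (h1 hx) y (j1 hy)
  · exact fun e => h.2 y (h1 hy) x (j1 hx) e.symm
  · exact j2 x hx y hy hxy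

theorem ind_singleton {V : Type} {G : SimpleGraph V} (v : V) : Ind G {v} := by
  intro x hx y hy hxy
  simp at hx hy
  exact absurd (hx.trans hy.symm) hxy

theorem one_le_al {V : Type} {G : SimpleGraph V} {A : Finset V} (h : A.Nonempty) : 1 ≤ al G A := by
  obtain ⟨v, hv⟩ := h
  have := card_le_al (G := G) (I := {v}) (U := A) (by simpa using hv) (ind_singleton v)
  simpa using this

theorem al_empty {V : Type} {G : SimpleGraph V} : al G ∅ = 0 := by
  have := al_le_card (G := G) ∅
  simpa using this

theorem exists_edge {V : Type} {G : SimpleGraph V} {A : Finset V} (h : al G A < A.card) :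
    ∃ x ∈ A, ∃ y ∈ A, G.Adj x y := by
  by_contra hc
  push Not at hc
  have := card_le_al (G := G) (subset_refl A) (fun x hx y hy _ => hc x hx y hy)
  omega

/-- closed neighbourhood of a set `I` inside `U` -/
noncomputable def cn {V : Type} (G : SimpleGraph V) (U I : Finset V) : Finset V :=
  U.filter fun v => v ∈ I ∨ ∃ i ∈ I, G.Adj i v

theorem sep_cn {V : Type} {G : SimpleGraph V} {U I : Finset V} : Sep G I (U \ cn G U I) := by
  constructor
  · rw [Finset.disjoint_left]
    intro a ha hb
    simp only [mem_sdiff, cn, mem_filter] at hb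
    exact hb.2 ⟨hb.1, Or.inl ha⟩
  · intro a ha b hb hab
    simp only [mem_sdiff, cn, mem_filter] at hb
    exact hb.2 ⟨hb.1, Or.inr ⟨a, ha, hab⟩⟩

theorem al_ind {V : Type} {G : SimpleGraph V} {I : Finset V} (h : Ind G I) : al G I = I.card :=
  le_antisymm (al_le_card I) (card_le_al (subset_refl _) h)

theorem al_sdiff_cn {V : Type} {G : SimpleGraph V} {U I : Finset V} (hU : I ⊆ U) (h : Ind G I) :
    al G (U \ cn G U I) + I.card ≤ al G U := by
  have h1 := al_union_ge (sep_cn (G := G) (U := U) (I := I))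
  rw [al_ind h] at h1
  have h2 : al G (I ∪ (U \ cn G U I)) ≤ al G U := al_mono (union_subset hU sdiff_subset)
  omega

/-- list path in `S` -/
structure Pth {V : Type} (G : SimpleGraph V) (S : Finset V) (l : List V) : Prop where
  ch : l.IsChain G.Adj
  nd : l.Nodup
  sub : ∀ x ∈ l, x ∈ S

def PV {V : Type} (G : SimpleGraph V) (S : Finset V) (u v : V) (m : ℕ) : Prop :=
  ∃ l : List V, Pth G S l ∧ l.head? = some u ∧ l.getLast? = some v ∧ l.length = m

theorem Pth.mono {V : Type} {G : SimpleGraph V} {S T : Finset V} {l : List V} (h : Pth G S l)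
    (hST : S ⊆ T) : Pth G T l := ⟨h.ch, h.nd, fun x hx => hST (h.sub x hx)⟩

theorem PV.mono {V : Type} {G : SimpleGraph V} {S T : Finset V} {u v : V} {m : ℕ}
    (h : PV G S u v m) (hST : S ⊆ T) : PV G T u v m := by
  obtain ⟨l, h1, h2⟩ := h
  exact ⟨l, h1.mono hST, h2⟩

theorem Pth.reverse {V : Type} {G : SimpleGraph V} {S : Finset V} {l : List V} (h : Pth G S l) :
    Pth G S l.reverse := by
  refine ⟨?_, List.nodup_reverse.2 h.nd, fun x hx => h.sub x (by simpa using hx)⟩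
  rw [List.isChain_reverse]
  exact h.ch.imp fun a b hab => hab.symm

theorem PV.symm {V : Type} {G : SimpleGraph V} {S : Finset V} {u v : V} {m : ℕ}
    (h : PV G S u v m) : PV G S v u m := by
  obtain ⟨l, h1, h2, h3, h4⟩ := h
  exact ⟨l.reverse, h1.reverse, by simpa using h3, by simpa using h2, by simpa using h4⟩

theorem PV.single {V : Type} {G : SimpleGraph V} {S : Finset V} {u : V} (h : u ∈ S) :
    PV G S u u 1 := ⟨[u], ⟨List.isChain_singleton _, by simp, by simpa using h⟩, by simp⟩

theorem Pth.append {V : Type} {G : SimpleGraph V} {S T : Finset V} {l l' : List V}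
    (h : Pth G S l) (h' : Pth G T l') (hd : ∀ x ∈ l, x ∉ l')
    (hadj : ∀ x ∈ l.getLast?, ∀ y ∈ l'.head?, G.Adj x y) : Pth G (S ∪ T) (l ++ l') := by
  refine ⟨List.isChain_append.2 ⟨h.ch, h'.ch, hadj⟩, ?_, ?_⟩
  · rw [List.nodup_append]
    refine ⟨h.nd, h'.nd, ?_⟩
    rintro a ha b hb rfl
    exact hd a ha hb
  · intro x hx
    rcases List.mem_append.1 hx with hx | hx
    · exact mem_union_left _ (h.sub x hx)
    · exact mem_union_right _ (h'.sub x hx)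

theorem PV.append {V : Type} {G : SimpleGraph V} {S T : Finset V} {u v u' v' : V} {m m' : ℕ}
    (h : PV G S u v m) (h' : PV G T u' v' m') (hST : Disjoint S T) (hadj : G.Adj v u') :
    PV G (S ∪ T) u v' (m + m') := by
  obtain ⟨l, h1, h2, h3, h4⟩ := h
  obtain ⟨l', h1', h2', h3', h4'⟩ := h'
  refine ⟨l ++ l', h1.append h1' ?_ ?_, ?_, ?_, by simp [h4, h4']⟩
  · intro x hx hx'
    exact Finset.disjoint_left.1 hST (h1.sub x hx) (h1'.sub x hx')
  · rw [h3, h2']; simpa using hadj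
  · rw [List.head?_append, h2]; rfl
  · rw [List.getLast?_append, h3']; rfl

theorem PV.left_mem {V : Type} {G : SimpleGraph V} {S : Finset V} {u v : V} {m : ℕ}
    (h : PV G S u v m) : u ∈ S := by
  obtain ⟨l, h1, h2, h3, h4⟩ := h
  exact h1.sub u (List.mem_of_mem_head? h2)

theorem PV.right_mem {V : Type} {G : SimpleGraph V} {S : Finset V} {u v : V} {m : ℕ}
    (h : PV G S u v m) : v ∈ S := h.symm.left_mem

theorem PV.one_le {V : Type} {G : SimpleGraph V} {S : Finset V} {u v : V} {m : ℕ}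
    (h : PV G S u v m) : 1 ≤ m := by
  obtain ⟨l, h1, h2, h3, h4⟩ := h
  rcases l with _ | ⟨a, l⟩
  · simp at h2
  · simp at h4; omega

theorem PV.cycle {V : Type} {G : SimpleGraph V} {S : Finset V} {u v : V} {m : ℕ}
    (h : PV G S u v m) (hvu : G.Adj v u) (hm : 3 ≤ m) : HasCycleLength G m := by
  obtain ⟨l, h1, h2, h3, h4⟩ := h
  have hne : l ≠ [] := by rintro rfl; simp at h2
  let p := Walk.ofSupport (G := G) l hne h1.ch
  have e1 : l.head hne = u := by
    have := List.head?_eq_some_head hne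
    rw [h2] at this; exact (Option.some.inj this).symm
  have e2 : l.getLast hne = v := by
    have := List.getLast?_eq_some_getLast hne
    rw [h3] at this; exact (Option.some.inj this).symm
  have hadj : G.Adj (l.getLast hne) (l.head hne) := by rw [e1, e2]; exact hvu
  have hs : p.support = l := Walk.support_ofSupport hne h1.ch
  have hl : p.length = l.length - 1 := Walk.length_ofSupport hne h1.ch
  refine ⟨_, Walk.cons hadj p, ?_, ?_⟩
  · rw [Walk.isCycle_iff_isPath_tail_and_le_length]
    constructor
    · simp only [Walk.tail_cons, Walk.getVert_cons_succ, Walk.isPath_copy]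
      rw [Walk.isPath_def, hs]
      exact h1.nd
    · rw [Walk.length_cons, hl]; omega
  · rw [Walk.length_cons, hl]; omega

def Clq {V : Type} (G : SimpleGraph V) (R : Finset V) : Prop :=
  ∀ x ∈ R, ∀ y ∈ R, x ≠ y → G.Adj x y

theorem Clq.subset {V : Type} {G : SimpleGraph V} {A B : Finset V} (h : A ⊆ B) (hB : Clq G B) :
    Clq G A := fun x hx y hy => hB x (h hx) y (h hy)

theorem Clq.pv {V : Type} {G : SimpleGraph V} {R : Finset V} (hR : Clq G R) :
    ∀ (m : ℕ) {u v : V}, u ∈ R → v ∈ R → u ≠ v → 2 ≤ m → m ≤ R.card → PV G R u v m := by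
  intro m
  induction m generalizing R with
  | zero => intro u v _ _ _ h; omega
  | succ m ih =>
    intro u v hu hv huv h2 hm
    have hvE : v ∈ R.erase u := by simp [hv, huv.symm]
    have key : ∀ w ∈ R.erase u, PV G (R.erase u) w v m → PV G R u v (m+1) := by
      intro w hw hp
      have := (PV.single (G := G) (Finset.mem_singleton_self u)).append hp
        (by simp) (hR u hu w (mem_of_mem_erase hw) (by simpa [eq_comm] using (mem_erase.1 hw).1))
      rw [add_comm] at this
      exact this.mono (union_subset (by simpa using hu) (erase_subset _ _))
    have hc : (R.erase u).card = R.card - 1 := card_erase_of_mem hu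
    rcases Nat.lt_or_ge m 2 with h | h
    · obtain rfl : m = 1 := by omega
      exact key v hvE (PV.single hvE)
    · have : 1 < (R.erase u).card := by omega
      obtain ⟨w, hw, hwv⟩ := Finset.exists_mem_ne this v
      exact key w hw (ih (hR.subset (erase_subset _ _)) hw hvE hwv h (by omega))

theorem Clq.cycle {V : Type} {G : SimpleGraph V} {R : Finset V} (hR : Clq G R) {ℓ : ℕ}
    (h3 : 3 ≤ ℓ) (h : ℓ ≤ R.card) : HasCycleLength G ℓ := by
  obtain ⟨u, hu, v, hv, huv⟩ := Finset.one_lt_card.1 (show 1 < R.card by omega)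
  exact (hR.pv ℓ hu hv huv (by omega) h).cycle (hR v hv u hu huv.symm) h3

theorem clq_of_al {V : Type} {G : SimpleGraph V} {R : Finset V} (h : al G R ≤ 1) : Clq G R := by
  intro x hx y hy hxy
  by_contra hc
  have : ({x, y} : Finset V).card ≤ al G R := by
    apply card_le_al
    · intro z hz; simp at hz; rcases hz with rfl | rfl <;> assumption
    · intro a ha b hb hab
      simp at ha hb
      rcases ha with rfl | rfl <;> rcases hb with rfl | rfl
      · exact absurd rfl hab
      · exact hc
      · exact fun h => hc h.symm
      · exact absurd rfl hab
  rw [card_pair hxy] at this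
  omega

/-- shortening -/
theorem PV.shorten {V : Type} {G : SimpleGraph V} {S : Finset V} {u v : V} {m k : ℕ}
    (h : PV G S u v m) (hk : al G S ≤ k) (hm : 2 * k + 2 ≤ m) :
    ∃ m', m ≤ m' + 2 * k ∧ m' < m ∧ PV G S u v m' := by
  obtain ⟨l, h1, h2, h3, h4⟩ := h
  subst h4
  have hinj : ∀ i j (hi : i < l.length) (hj : j < l.length), l[i] = l[j] → i = j := by
    intro i j hi hj e
    exact (List.Nodup.getElem_inj_iff h1.nd).1 e
  let f : ℕ → V := fun i => if h : 2 * i < l.length then l[2*i] else u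
  have hf : ∀ i (h : 2 * i < l.length), f i = l[2*i] := fun i h => by simp [f, h]
  let P := (Finset.range (k+1)).image f
  have hP : P.card = k + 1 := by
    rw [Finset.card_image_of_injOn, card_range]
    intro i hi j hj e
    simp at hi hj
    rw [hf i (by omega), hf j (by omega)] at e
    have := hinj _ _ _ _ e
    omega
  have hPS : P ⊆ S := by
    intro x hx
    simp only [P, mem_image, mem_range] at hx
    obtain ⟨i, hi, rfl⟩ := hx
    rw [hf i (by omega)]
    exact h1.sub _ (List.getElem_mem _)
  have : al G P < P.card := lt_of_le_of_lt (al_mono hPS) (by omega)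
  obtain ⟨x, hx, y, hy, hxy⟩ := exists_edge this
  simp only [P, mem_image, mem_range] at hx hy
  obtain ⟨i, hi, rfl⟩ := hx
  obtain ⟨j, hj, rfl⟩ := hy
  have main : ∀ i j, i < j → j < k + 1 → G.Adj (f i) (f j) →
      ∃ m', l.length ≤ m' + 2 * k ∧ m' < l.length ∧ PV G S u v m' := by
    intro i j hij hj hadj
    rw [hf i (by omega), hf j (by omega)] at hadj
    refine ⟨(l.take (2*i+1) ++ l.drop (2*j)).length, ?_, ?_, l.take (2*i+1) ++ l.drop (2*j),
      ⟨?_, ?_, ?_⟩, ?_, ?_, rfl⟩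
    · simp; omega
    · simp; omega
    · rw [List.isChain_append]
      refine ⟨h1.ch.take _, h1.ch.drop _, ?_⟩
      intro a ha b hb
      rw [List.getLast?_take] at ha
      rw [List.head?_drop] at hb
      simp only [Nat.add_sub_cancel] at ha
      rw [List.getElem?_eq_getElem (by omega)] at ha hb
      simp at ha hb
      rw [← ha, ← hb]; exact hadj
    · rw [List.nodup_append]
      refine ⟨h1.nd.sublist (List.take_sublist _ _), h1.nd.sublist (List.drop_sublist _ _), ?_⟩
      rintro a ha b hb rfl
      have := List.disjoint_take_drop h1.nd (show 2*i+1 ≤ 2*j by omega)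
      exact this ha hb
    · intro x hx
      rcases List.mem_append.1 hx with hx | hx
      · exact h1.sub x (List.mem_of_mem_take hx)
      · exact h1.sub x (List.mem_of_mem_drop hx)
    · rw [List.head?_append, List.head?_take, h2]; simp
    · rw [List.getLast?_append, List.getLast?_drop, h3]
      rw [if_neg (by omega)]; rfl
  rcases Nat.lt_trichotomy i j with h | h | h
  · exact main i j h hj hxy
  · subst h; exact absurd hxy (G.irrefl)
  · exact main j i h hi hxy.symm

theorem PV.hit {V : Type} {G : SimpleGraph V} {S : Finset V} {u v : V} {k T : ℕ} :
    ∀ {m : ℕ}, PV G S u v m → al G S ≤ k → 2 * k + 2 ≤ T → T ≤ m →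
    ∃ m', T ≤ m' + 2 * k ∧ m' ≤ T ∧ PV G S u v m' := by
  intro m
  induction m using Nat.strong_induction_on with
  | _ m ih =>
    intro h hk hT hm
    rcases hm.eq_or_lt with rfl | hlt
    · exact ⟨T, by omega, le_refl _, h⟩
    · obtain ⟨m', a, b, c⟩ := h.shorten hk (by omega)
      rcases Nat.lt_or_ge m' T with h' | h'
      · exact ⟨m', by omega, h'.le, c⟩
      · exact ih m' b c hk hT h'

end CycP

open SimpleGraph Finset
namespace CycP
open scoped Classical

noncomputable def ball {V : Type} (G : SimpleGraph V) (S : Finset V) (x : V) : ℕ → Finset V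
  | 0 => {x}
  | j+1 => S.filter fun v => v ∈ ball G S x j ∨ ∃ w ∈ ball G S x j, G.Adj w v

theorem mem_ball_succ {V : Type} {G : SimpleGraph V} {S : Finset V} {x v : V} {j : ℕ} :
    v ∈ ball G S x (j+1) ↔ v ∈ S ∧ (v ∈ ball G S x j ∨ ∃ w ∈ ball G S x j, G.Adj w v) := by
  simp [ball]

theorem mem_ball_zero {V : Type} {G : SimpleGraph V} {S : Finset V} {x v : V} :
    v ∈ ball G S x 0 ↔ v = x := by
  simp [ball]

theorem ball_subset {V : Type} {G : SimpleGraph V} {S : Finset V} {x : V} (hx : x ∈ S) (j : ℕ) :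
    ball G S x j ⊆ S := by
  cases j with
  | zero => intro v hv; rw [mem_ball_zero] at hv; rwa [hv]
  | succ j => exact filter_subset _ _

theorem ball_succ {V : Type} {G : SimpleGraph V} {S : Finset V} {x : V} (hx : x ∈ S) (j : ℕ) :
    ball G S x j ⊆ ball G S x (j+1) := by
  intro v hv
  rw [mem_ball_succ]
  exact ⟨ball_subset hx j hv, Or.inl hv⟩

theorem ball_mono {V : Type} {G : SimpleGraph V} {S : Finset V} {x : V} (hx : x ∈ S) {i j : ℕ}
    (h : i ≤ j) : ball G S x i ⊆ ball G S x j := by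
  induction h with
  | refl => exact subset_refl _
  | step _ ih => exact ih.trans (ball_succ hx _)

theorem self_mem_ball {V : Type} {G : SimpleGraph V} {S : Finset V} {x : V} (hx : x ∈ S) (j : ℕ) :
    x ∈ ball G S x j := ball_mono hx (Nat.zero_le j) (by simp [ball])

theorem ball_adj {V : Type} {G : SimpleGraph V} {S : Finset V} {x w v : V} {j : ℕ}
    (hw : w ∈ ball G S x j) (hv : v ∈ S) (h : G.Adj w v) : v ∈ ball G S x (j+1) := by
  rw [mem_ball_succ]; exact ⟨hv, Or.inr ⟨w, hw, h⟩⟩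

theorem ball_sub {V : Type} {G : SimpleGraph V} {S T : Finset V} {x : V} (h : S ⊆ T) (j : ℕ) :
    ball G S x j ⊆ ball G T x j := by
  induction j with
  | zero => simp [ball]
  | succ j ih =>
    intro v hv
    rw [mem_ball_succ] at hv ⊢
    rcases hv with ⟨h1, h2 | ⟨w, h2, h3⟩⟩
    · exact ⟨h h1, Or.inl (ih h2)⟩
    · exact ⟨h h1, Or.inr ⟨w, ih h2, h3⟩⟩

theorem ball_path {V : Type} {G : SimpleGraph V} {S : Finset V} {x : V} (hx : x ∈ S) {v : V} :
    ∀ {j : ℕ}, v ∈ ball G S x j → ∃ m, m ≤ j + 1 ∧ PV G (ball G S x j) x v m := by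
  intro j
  induction j generalizing v with
  | zero =>
    intro h
    rw [mem_ball_zero] at h
    subst h
    exact ⟨1, by omega, PV.single (by simp [ball])⟩
  | succ j ih =>
    intro h
    by_cases hv : v ∈ ball G S x j
    · obtain ⟨m, h1, h2⟩ := ih hv
      exact ⟨m, by omega, h2.mono (ball_succ hx j)⟩
    · obtain ⟨w, hw, hwv⟩ := (mem_ball_succ.1 h).2.resolve_left hv
      obtain ⟨m, h1, h2⟩ := ih hw
      refine ⟨m + 1, by omega, ?_⟩
      exact (h2.append (PV.single (mem_singleton_self v)) (by simpa using hv) hwv).mono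
        (union_subset (ball_succ hx j) (by simpa using h))

theorem ball_trans {V : Type} {G : SimpleGraph V} {S : Finset V} {x v w : V} (hx : x ∈ S) {i j : ℕ}
    (h : v ∈ ball G S x i) (h' : w ∈ ball G S v j) : w ∈ ball G S x (i + j) := by
  induction j generalizing w with
  | zero => rw [mem_ball_zero] at h'; rwa [h']
  | succ j ih =>
    rcases mem_ball_succ.1 h' with ⟨h1, h2 | ⟨u, h2, h3⟩⟩
    · exact ball_succ hx _ (ih h2)
    · exact ball_adj (ih h2) h1 h3

theorem ball_symm {V : Type} {G : SimpleGraph V} {S : Finset V} {x v : V} (hx : x ∈ S) {j : ℕ}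
    (h : v ∈ ball G S x j) : x ∈ ball G S v j := by
  have hv := ball_subset hx j h
  induction j generalizing v with
  | zero => rw [mem_ball_zero] at h ⊢; exact h.symm
  | succ j ih =>
    rcases mem_ball_succ.1 h with ⟨h1, h2 | ⟨u, h2, h3⟩⟩
    · exact ball_succ hv _ (ih h2 hv)
    · have huS := ball_subset hx j h2
      have := ih h2 huS
      have h5 : u ∈ ball G S v 1 := ball_adj (self_mem_ball hv 0) huS h3.symm
      have := ball_trans hv h5 this
      rwa [add_comm] at this

noncomputable def Reach {V : Type} (G : SimpleGraph V) (S : Finset V) (x : V) : Finset V :=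
  S.filter fun v => ∃ j, v ∈ ball G S x j

theorem mem_reach {V : Type} {G : SimpleGraph V} {S : Finset V} {x v : V} :
    v ∈ Reach G S x ↔ v ∈ S ∧ ∃ j, v ∈ ball G S x j := by simp [Reach]

theorem reach_subset {V : Type} {G : SimpleGraph V} {S : Finset V} {x : V} : Reach G S x ⊆ S :=
  filter_subset _ _

theorem self_mem_reach {V : Type} {G : SimpleGraph V} {S : Finset V} {x : V} (hx : x ∈ S) :
    x ∈ Reach G S x := mem_reach.2 ⟨hx, 0, self_mem_ball hx 0⟩

theorem ball_subset_reach {V : Type} {G : SimpleGraph V} {S : Finset V} {x : V} (hx : x ∈ S)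
    (j : ℕ) : ball G S x j ⊆ Reach G S x :=
  fun _ hv => mem_reach.2 ⟨ball_subset hx j hv, j, hv⟩

theorem reach_adj {V : Type} {G : SimpleGraph V} {S : Finset V} {x w v : V}
    (hw : w ∈ Reach G S x) (hv : v ∈ S) (h : G.Adj w v) : v ∈ Reach G S x := by
  obtain ⟨_, j, hj⟩ := mem_reach.1 hw
  exact mem_reach.2 ⟨hv, j+1, ball_adj hj hv h⟩

theorem reach_mono {V : Type} {G : SimpleGraph V} {S T : Finset V} {x : V} (h : S ⊆ T) :
    Reach G S x ⊆ Reach G T x := by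
  intro v hv
  obtain ⟨h1, j, hj⟩ := mem_reach.1 hv
  exact mem_reach.2 ⟨h h1, j, ball_sub h j hj⟩

theorem reach_trans {V : Type} {G : SimpleGraph V} {S : Finset V} {x v w : V} (hx : x ∈ S)
    (h : v ∈ Reach G S x) (h' : w ∈ Reach G S v) : w ∈ Reach G S x := by
  obtain ⟨h1, j, hj⟩ := mem_reach.1 h
  obtain ⟨h1', j', hj'⟩ := mem_reach.1 h'
  exact mem_reach.2 ⟨h1', _, ball_trans hx hj hj'⟩

theorem reach_symm {V : Type} {G : SimpleGraph V} {S : Finset V} {x v : V} (hx : x ∈ S)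
    (h : v ∈ Reach G S x) : x ∈ Reach G S v := by
  obtain ⟨h1, j, hj⟩ := mem_reach.1 h
  exact mem_reach.2 ⟨hx, _, ball_symm hx hj⟩

theorem reach_sep {V : Type} {G : SimpleGraph V} {S : Finset V} {x : V} :
    Sep G (Reach G S x) (S \ Reach G S x) := by
  refine ⟨disjoint_sdiff, ?_⟩
  intro a ha b hb hab
  rw [mem_sdiff] at hb
  exact hb.2 (reach_adj ha hb.1 hab)

theorem reach_path {V : Type} {G : SimpleGraph V} {S : Finset V} {x v : V} (hx : x ∈ S)
    (h : v ∈ Reach G S x) : ∃ m, PV G (Reach G S x) x v m := by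
  obtain ⟨h1, j, hj⟩ := mem_reach.1 h
  obtain ⟨m, _, hm⟩ := ball_path hx hj
  exact ⟨m, hm.mono (ball_subset_reach hx j)⟩

/-- the first vertices of a path outside -/
theorem exists_min {V : Type} (P : Finset V → Prop) {U : Finset V} (hU : P U) :
    ∃ H, H ⊆ U ∧ P H ∧ ∀ U', U' ⊂ H → ¬ P U' := by
  induction U using Finset.strongInduction with
  | _ U ih =>
    by_cases h : ∃ U', U' ⊂ U ∧ P U'
    · obtain ⟨U', h1, h2⟩ := h
      obtain ⟨H, a, b⟩ := ih U' h1 h2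
      exact ⟨H, a.trans h1.subset, b⟩
    · push Not at h
      exact ⟨U, subset_refl _, hU, h⟩

theorem exists_min_f {V : Type} (G : SimpleGraph V) (f : ℕ → ℝ) {U : Finset V} (hne : U.Nonempty)
    (hU : f (al G U) ≤ U.card) :
    ∃ H, H ⊆ U ∧ H.Nonempty ∧ f (al G H) ≤ H.card ∧
      ∀ U', U' ⊂ H → U'.Nonempty → (U'.card : ℝ) < f (al G U') := by
  obtain ⟨H, h1, h2, h3⟩ := exists_min (fun U => U.Nonempty ∧ f (al G U) ≤ U.card) ⟨hne, hU⟩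
  refine ⟨H, h1, h2.1, h2.2, ?_⟩
  intro U' hU' hn
  by_contra hc
  exact h3 U' hU' ⟨hn, not_lt.1 hc⟩

theorem exists_incr {V : Type} (G : SimpleGraph V) (r : V → ℕ) :
    ∀ (m : ℕ) (S : Finset V), (∀ x ∈ S, ∀ y ∈ S, r x = r y → x = y) →
    m * al G S < S.card → ∃ l : List V, l.IsChain (fun a b => G.Adj a b ∧ r a < r b) ∧
      (∀ x ∈ l, x ∈ S) ∧ l.length = m + 1 := by
  intro m
  induction m with
  | zero =>
    intro S hr h
    obtain ⟨v, hv⟩ := card_pos.1 (by omega : 0 < S.card)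
    exact ⟨[v], List.isChain_singleton _, by simpa using hv, by simp⟩
  | succ m ih =>
    intro S hr h
    let S' := S.filter fun v => ∃ u ∈ S, G.Adj u v ∧ r u < r v
    have hS' : S' ⊆ S := filter_subset _ _
    have hind : Ind G (S \ S') := by
      intro x hx y hy hxy hadj
      simp only [S', mem_sdiff, mem_filter, not_and, not_exists] at hx hy
      rcases Nat.lt_trichotomy (r x) (r y) with h' | h' | h'
      · exact hy.2 hy.1 x hx.1 hadj h'
      · exact hxy (hr x hx.1 y hy.1 h')
      · exact hx.2 hx.1 y hy.1 hadj.symm h'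
    have h1 := card_le_al (sdiff_subset (s := S) (t := S')) hind
    have h2 : S'.card + (S \ S').card = S.card := by
      rw [add_comm]; exact card_sdiff_add_card_eq_card hS'
    have h3 : m * al G S' ≤ m * al G S := Nat.mul_le_mul_left _ (al_mono hS')
    have h4 : (m+1) * al G S = m * al G S + al G S := by ring
    obtain ⟨l, a, b, c⟩ := ih S' (fun x hx y hy => hr x (hS' hx) y (hS' hy)) (by omega)
    rcases l with _ | ⟨v, l⟩
    · simp at c
    · have hv := b v (by simp)
      simp only [S', mem_filter] at hv
      obtain ⟨hvS, u, hu, huv⟩ := hv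
      refine ⟨u :: v :: l, ?_, ?_, by simpa using c⟩
      · rw [List.isChain_cons]
        exact ⟨by simpa using huv, a⟩
      · intro x hx
        rcases List.mem_cons.1 hx with rfl | hx
        · exact hu
        · exact hS' (b x hx)

end CycP

open SimpleGraph Finset
namespace CycP
open scoped Classical

theorem layer_lemma {V : Type} {G : SimpleGraph V} (H : Finset V) (L : ℕ → Finset V) (par : V → V)
    (v : V) (hLH : ∀ i, L i ⊆ H) (hdis : ∀ i j x, x ∈ L i → x ∈ L j → i = j)
    (h0 : L 0 = {v}) (hpar : ∀ i, ∀ w ∈ L (i+1), par w ∈ L i ∧ G.Adj (par w) w)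
    {i ℓ : ℕ} (hℓ : 3 ≤ ℓ) (hi : 2 * i + 1 ≤ ℓ)
    (hbig : (ℓ - 2) * al G (L i) < (L i).card) : HasCycleLength G ℓ := by
  -- index
  obtain ⟨idx, N, hidx, hN⟩ : ∃ (idx : V → ℕ) (N : ℕ), (∀ x ∈ H, ∀ y ∈ H, idx x = idx y → x = y) ∧
      ∀ x ∈ H, idx x < N := by
    refine ⟨fun w => if h : w ∈ H then (H.equivFin ⟨w, h⟩ : ℕ) else 0, H.card, ?_, ?_⟩
    · intro x hx y hy e
      simp only [hx, hy, dif_pos] at e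
      have := H.equivFin.injective (Fin.ext e)
      simpa using this
    · intro x hx
      simp only [hx, dif_pos]
      exact Fin.is_lt _
  let key : ℕ → V → ℕ := fun i => Nat.rec (fun _ => 0) (fun _ f w => f (par w) * N + idx w) i
  have key_succ : ∀ i w, key (i+1) w = key i (par w) * N + idx w := fun _ _ => rfl
  have kmono : ∀ i, ∀ x ∈ L (i+1), ∀ y ∈ L (i+1), key (i+1) x ≤ key (i+1) y →
      key i (par x) ≤ key i (par y) := by
    intro i x hx y hy h
    by_contra hc
    push Not at hc
    rw [key_succ, key_succ] at h
    have h1 : (key i (par y) + 1) * N ≤ key i (par x) * N := Nat.mul_le_mul_right _ hc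
    have h2 := hN y (hLH _ hy)
    have h3 : (key i (par y) + 1) * N = key i (par y) * N + N := by ring
    omega
  have kinj : ∀ i, ∀ x ∈ L i, ∀ y ∈ L i, key i x = key i y → x = y := by
    intro i x hx y hy h
    cases i with
    | zero =>
      rw [h0, mem_singleton] at hx hy
      rw [hx, hy]
    | succ i =>
      have a := kmono i x hx y hy h.le
      have b := kmono i y hy x hx h.ge
      have e := le_antisymm a b
      rw [key_succ, key_succ, e] at h
      exact hidx x (hLH _ hx) y (hLH _ hy) (by omega)
  have hit : ∀ d i, ∀ w ∈ L (i + d), par^[d] w ∈ L i := by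
    intro d
    induction d with
    | zero => intro i w hw; exact hw
    | succ d ih =>
      intro i w hw
      rw [Function.iterate_succ_apply]
      exact ih i _ (hpar (i+d) w hw).1
  have kit : ∀ d i, ∀ x ∈ L (i + d), ∀ y ∈ L (i+d), key (i+d) x ≤ key (i+d) y →
      key i (par^[d] x) ≤ key i (par^[d] y) := by
    intro d
    induction d with
    | zero => intro i x _ y _ h; exact h
    | succ d ih =>
      intro i x hx y hy h
      rw [Function.iterate_succ_apply, Function.iterate_succ_apply]
      exact ih i _ (hpar (i+d) x hx).1 _ (hpar (i+d) y hy).1 (kmono (i+d) x hx y hy h)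
  obtain ⟨l, l1, l2, l3⟩ := exists_incr G (key i) (ℓ - 2) (L i) (kinj i) hbig
  set M := ℓ - 2 with hM
  let p : ℕ → V := fun j => l.getD j v
  have hp : ∀ j (h : j < l.length), p j = l[j] := fun j h => by simp [p, h]
  have pL : ∀ j, j ≤ M → p j ∈ L i := by
    intro j hj
    rw [hp j (by omega)]
    exact l2 _ (List.getElem_mem _)
  have pch : ∀ j, j < M → G.Adj (p j) (p (j+1)) ∧ key i (p j) < key i (p (j+1)) := by
    intro j hj
    rw [hp j (by omega), hp (j+1) (by omega)]
    exact List.isChain_iff_getElem.1 l1 j (by omega)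
  have pmono : ∀ b a, a < b → b ≤ M → key i (p a) < key i (p b) := by
    intro b
    induction b with
    | zero => intro a h; omega
    | succ b ih =>
      intro a hab hb
      have := (pch b (by omega)).2
      rcases Nat.lt_or_ge a b with h | h
      · exact (ih a h (by omega)).trans this
      · obtain rfl : a = b := by omega
        exact this
  have pmono' : ∀ a b, a ≤ b → b ≤ M → key i (p a) ≤ key i (p b) := by
    intro a b hab hb
    rcases hab.eq_or_lt with rfl | h
    · exact le_refl _
    · exact (pmono b a h hb).le
  have pinj : ∀ a b, a ≤ M → b ≤ M → p a = p b → a = b := by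
    intro a b ha hb e
    rcases Nat.lt_trichotomy a b with h | h | h
    · have := pmono b a h hb; rw [e] at this; omega
    · exact h
    · have := pmono a b h ha; rw [e] at this; omega
  -- sandwich
  have sand : ∀ d, d ≤ i → ∀ a b c, a ≤ b → b ≤ c → c ≤ M → par^[d] (p a) = par^[d] (p c) →
      par^[d] (p b) = par^[d] (p a) := by
    intro d hd a b c hab hbc hc e
    obtain ⟨i', rfl⟩ : ∃ i', i = i' + d := ⟨i - d, by omega⟩
    have pa := pL a (by omega)
    have pb := pL b (by omega)
    have pc := pL c (by omega)
    have k1 := kit d i' _ pa _ pb (pmono' a b hab (by omega))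
    have k2 := kit d i' _ pb _ pc (pmono' b c hbc (by omega))
    rw [← e] at k2
    exact kinj i' _ (hit d i' _ pb) _ (hit d i' _ pa) (le_antisymm k2 k1)
  have hQi : par^[i] (p 0) = par^[i] (p M) := by
    have a := hit i 0 (p 0) (by simpa using pL 0 (by omega))
    have b := hit i 0 (p M) (by simpa using pL M (by omega))
    rw [h0, mem_singleton] at a b
    rw [a, b]
  have hex : ∃ d, par^[d] (p 0) = par^[d] (p M) := ⟨i, hQi⟩
  set d := Nat.find hex with hd
  have hdi : d ≤ i := Nat.find_min' hex hQi
  have hdq := Nat.find_spec hex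
  rw [← hd] at hdq
  have hd1 : 1 ≤ d := by
    by_contra hc
    have : d = 0 := by omega
    rw [this] at hdq
    have := pinj 0 M (by omega) (by omega) hdq
    omega
  have hdm : par^[d-1] (p 0) ≠ par^[d-1] (p M) := Nat.find_min hex (by omega)
  obtain ⟨Len, hLen⟩ : ∃ Len, ℓ = Len + 2 * d := ⟨ℓ - 2 * d, by omega⟩
  have hL1 : 1 ≤ Len := by omega
  have hLM : Len ≤ M := by omega
  obtain ⟨a, ha, hane⟩ : ∃ a, a + Len ≤ M ∧ par^[d-1] (p a) ≠ par^[d-1] (p (a + Len)) := by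
    by_contra hc
    push Not at hc
    apply hdm
    have : ∀ j, j ≤ M → par^[d-1] (p j) = par^[d-1] (p 0) := by
      intro j
      induction j using Nat.strong_induction_on with
      | _ j ih =>
        intro hj
        rcases Nat.lt_or_ge j Len with h | h
        · have e := hc 0 (by omega)
          exact sand (d-1) (by omega) 0 j (0 + Len) (by omega) (by omega) (by omega) e
        · have e := hc (j - Len) (by omega)
          rw [Nat.sub_add_cancel h] at e
          rw [← e]
          exact ih (j - Len) (by omega) (by omega)
    exact (this M (le_refl _)).symm
  -- levels
  have lev : ∀ j t, j ≤ M → t ≤ i → par^[t] (p j) ∈ L (i - t) := by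
    intro j t hj ht
    apply hit t (i - t)
    rw [Nat.sub_add_cancel ht]
    exact pL j hj
  have padj : ∀ j t, j ≤ M → t < i → G.Adj (par^[t] (p j)) (par^[t+1] (p j)) := by
    intro j t hj ht
    have h1 := lev j t hj ht.le
    rw [Function.iterate_succ_apply']
    have : i - t = (i - t - 1) + 1 := by omega
    rw [this] at h1
    exact (hpar _ _ h1).2.symm
  -- segment
  have seg : ∀ e, a + e ≤ M → PV G ((Finset.Icc a (a+e)).image p) (p a) (p (a+e)) (e+1) := by
    intro e
    induction e with
    | zero => intro _; exact PV.single (by simp)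
    | succ e ih =>
      intro he
      refine ((ih (by omega)).append (PV.single (mem_singleton_self (p (a+(e+1))))) ?_
        (pch (a+e) (by omega)).1).mono ?_
      · rw [Finset.disjoint_singleton_right]
        simp only [mem_image, mem_Icc, not_exists, not_and]
        intro x hx hpx
        have := pinj x _ (by omega) (by omega) hpx
        omega
      · intro x
        simp only [mem_union, mem_image, mem_Icc, mem_singleton]
        rintro (⟨y, hy, rfl⟩ | rfl)
        · exact ⟨y, by omega, rfl⟩
        · exact ⟨_, by omega, rfl⟩
  set S0 := (Finset.Icc a (a+Len)).image p with hS0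
  have hS0L : S0 ⊆ L i := by
    intro x hx
    simp only [hS0, mem_image, mem_Icc] at hx
    obtain ⟨y, hy, rfl⟩ := hx
    exact pL y (by omega)
  have right : ∀ e, e ≤ d → PV G (S0 ∪ (range (e+1)).image fun t => par^[t] (p (a+Len))) (p a)
      (par^[e] (p (a+Len))) (Len + 1 + e) := by
    intro e
    induction e with
    | zero => intro _; exact (seg Len ha).mono subset_union_left
    | succ e ih =>
      intro he
      refine ((ih (by omega)).append (PV.single (mem_singleton_self _)) ?_
        (padj (a+Len) e (by omega) (by omega))).mono ?_
      · rw [Finset.disjoint_singleton_right]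
        simp only [mem_union, mem_image, mem_range, not_or, not_exists, not_and]
        have hl := lev (a+Len) (e+1) (by omega) (by omega)
        refine ⟨fun hx => ?_, fun t ht he' => ?_⟩
        · have := hdis _ _ _ hl (hS0L hx); omega
        · rw [← he'] at hl
          have := hdis _ _ _ hl (lev (a+Len) t (by omega) (by omega)); omega
      · intro x
        simp only [mem_union, mem_image, mem_range, mem_singleton]
        rintro ((h | ⟨y, hy, rfl⟩) | rfl)
        · exact Or.inl h
        · exact Or.inr ⟨y, by omega, rfl⟩
        · exact Or.inr ⟨_, by omega, rfl⟩
  set S1 := S0 ∪ (range (d+1)).image fun t => par^[t] (p (a+Len)) with hS1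
  have hdall : ∀ t, t ≤ d - 1 → par^[t] (p a) ≠ par^[t] (p (a+Len)) := by
    intro t ht e
    apply hane
    have : d - 1 = (d - 1 - t) + t := by omega
    rw [this, Function.iterate_add_apply, Function.iterate_add_apply, e]
  have left : ∀ e, e ≤ d - 1 → PV G (S1 ∪ (range (e+1)).image fun t => par^[t] (p a))
      (par^[e] (p a)) (par^[d] (p (a+Len))) (Len + 1 + d + e) := by
    intro e
    induction e with
    | zero => intro _; exact (right d le_rfl).mono subset_union_left
    | succ e ih =>
      intro he
      apply PV.symm
      refine ((ih (by omega)).symm.append (PV.single (mem_singleton_self _)) ?_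
        (padj a e (by omega) (by omega))).mono ?_
      · rw [Finset.disjoint_singleton_right]
        simp only [hS1, mem_union, mem_image, mem_range, not_or, not_exists, not_and]
        have hl := lev a (e+1) (by omega) (by omega)
        refine ⟨⟨fun hx => ?_, fun t ht he' => ?_⟩, fun t ht he' => ?_⟩
        · have := hdis _ _ _ hl (hS0L hx); omega
        · have h2 := lev (a+Len) t (by omega) (by omega)
          rw [he'] at h2
          have := hdis _ _ _ hl h2
          obtain rfl : t = e + 1 := by omega
          exact hdall (e+1) (by omega) he'.symm
        · rw [← he'] at hl
          have := hdis _ _ _ hl (lev a t (by omega) (by omega)); omega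
      · intro x
        simp only [mem_union, mem_image, mem_range, mem_singleton]
        rintro ((h | ⟨y, hy, rfl⟩) | rfl)
        · exact Or.inl h
        · exact Or.inr ⟨y, by omega, rfl⟩
        · exact Or.inr ⟨_, by omega, rfl⟩
  have fin := left (d-1) le_rfl
  have hc : Len + 1 + d + (d-1) = ℓ := by omega
  rw [hc] at fin
  refine fin.cycle ?_ hℓ
  have t1 : par^[d] (p (a+Len)) = par^[d] (p a) := by
    have h1 := sand d hdi 0 (a+Len) M (by omega) ha le_rfl hdq
    have h2 := sand d hdi 0 a M (by omega) (by omega) le_rfl hdq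
    rw [h1, h2]
  rw [t1]
  have := padj a (d-1) (by omega) (by omega)
  rw [Nat.sub_add_cancel hd1] at this
  exact this.symm

theorem cn_large {V : Type} {G : SimpleGraph V} {H : Finset V} {D : ℝ} (hD : 0 ≤ D)
    (h1 : D * al G H ≤ H.card)
    (h2 : ∀ U', U' ⊂ H → U'.Nonempty → (U'.card : ℝ) < D * al G U') {I : Finset V} (hI : I ⊆ H)
    (hi : Ind G I) : D * I.card ≤ (cn G H I).card := by
  have hsub : cn G H I ⊆ H := filter_subset _ _
  have hc : ((H \ cn G H I).card : ℝ) + (cn G H I).card = H.card := by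
    exact_mod_cast card_sdiff_add_card_eq_card hsub
  have hal : (al G (H \ cn G H I) : ℝ) + I.card ≤ al G H := by
    exact_mod_cast al_sdiff_cn hI hi
  have hle : ((H \ cn G H I).card : ℝ) ≤ D * al G (H \ cn G H I) ∨ cn G H I = ∅ := by
    rcases (cn G H I).eq_empty_or_nonempty with h | ⟨w, hw⟩
    · exact Or.inr h
    · left
      rcases (H \ cn G H I).eq_empty_or_nonempty with h | h
      · rw [h]; simp only [card_empty, Nat.cast_zero]; positivity
      · refine (h2 _ ?_ h).le
        refine ⟨sdiff_subset, fun hs => ?_⟩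
        have := hs (hsub hw)
        simp [hw] at this
  rcases hle with hle | he
  · have : D * ((al G (H \ cn G H I) : ℝ) + I.card) ≤ D * al G H :=
      mul_le_mul_of_nonneg_left hal hD
    nlinarith
  · have hIe : I = ∅ := by
      rw [Finset.eq_empty_iff_forall_notMem]
      intro x hx
      have : x ∈ cn G H I := by simp only [cn, mem_filter]; exact ⟨hI hx, Or.inl hx⟩
      rw [he] at this; simp at this
    simp [hIe]

theorem small_regime {V : Type} {G : SimpleGraph V} {U : Finset V} {k ℓ : ℕ} {D : ℝ}
    (hk : al G U ≤ k) (hne : U.Nonempty) (hD : 2 * (k:ℝ) + 1 < D) (hU : D * al G U ≤ U.card)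
    (hℓ : 3 ≤ ℓ) (hℓk : 2 * (ℓ - 2) ≤ k) : HasCycleLength G ℓ := by
  by_contra hcon
  have hk0 : (0:ℝ) ≤ k := Nat.cast_nonneg _
  obtain ⟨H, hHU, hHne, hH1, hH2⟩ := exists_min_f G (fun a => D * a) hne hU
  have hcn := fun {I : Finset V} (h : I ⊆ H) (h' : Ind G I) =>
    cn_large (by linarith) hH1 hH2 h h'
  obtain ⟨v, hv⟩ := hHne
  obtain ⟨L, L0, LS⟩ : ∃ L : ℕ → Finset V, L 0 = {v} ∧
      ∀ j, L (j+1) = ball G H v (j+1) \ ball G H v j :=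
    ⟨fun i => Nat.rec {v} (fun j _ => ball G H v (j+1) \ ball G H v j) i, rfl, fun _ => rfl⟩
  have Lball : ∀ j, L j ⊆ ball G H v j := by
    intro j
    cases j with
    | zero => rw [L0]; simp [ball]
    | succ j => rw [LS]; exact sdiff_subset
  have LH : ∀ j, L j ⊆ H := fun j => (Lball j).trans (ball_subset hv j)
  have Lnot : ∀ i j x, i < j → x ∈ L j → x ∉ ball G H v i := by
    intro i j x hij hx
    obtain ⟨j, rfl⟩ : ∃ j', j = j' + 1 := ⟨j - 1, by omega⟩
    rw [LS, mem_sdiff] at hx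
    exact fun h => hx.2 (ball_mono hv (by omega) h)
  have hdis : ∀ i j x, x ∈ L i → x ∈ L j → i = j := by
    intro i j x hi hj
    rcases Nat.lt_trichotomy i j with h | h | h
    · exact absurd (Lball i hi) (Lnot i j x h hj)
    · exact h
    · exact absurd (Lball j hj) (Lnot j i x h hi)
  have hcov : ∀ i, ball G H v i ⊆ (Finset.range (i+1)).biUnion L := by
    intro i
    induction i with
    | zero => intro x hx; simpa [L0, ball] using hx
    | succ i ih =>
      intro x hx
      by_cases h : x ∈ ball G H v i
      · have := ih h
        simp only [mem_biUnion, mem_range] at this ⊢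
        obtain ⟨a, b, c⟩ := this
        exact ⟨a, by omega, c⟩
      · simp only [mem_biUnion, mem_range]
        exact ⟨i+1, by omega, by rw [LS, mem_sdiff]; exact ⟨hx, h⟩⟩
  have hparex : ∀ w, ∃ u, ∀ i, w ∈ L (i+1) → u ∈ L i ∧ G.Adj u w := by
    intro w
    by_cases h : ∃ i, w ∈ L (i+1)
    · obtain ⟨i, hi⟩ := h
      have hi' := hi
      rw [LS, mem_sdiff, mem_ball_succ] at hi
      obtain ⟨u, hu, huw⟩ := hi.1.2.resolve_left hi.2
      have := hcov i hu
      simp only [mem_biUnion, mem_range] at this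
      obtain ⟨j, hj, huj⟩ := this
      have hji : j = i := by
        by_contra hne'
        have := ball_adj (Lball j huj) hi.1.1 huw
        exact hi.2 (ball_mono hv (by omega) this)
      subst hji
      refine ⟨u, fun i' hi'' => ?_⟩
      have := hdis _ _ _ hi' hi''
      obtain rfl : i' = j := by omega
      exact ⟨huj, huw⟩
    · push Not at h
      exact ⟨w, fun i hi => absurd hi (h i)⟩
  choose par hpar using hparex
  have layer : ∀ i, 2 * i + 1 ≤ ℓ → (L i).card ≤ (ℓ - 2) * al G (L i) := by
    intro i hi
    by_contra hc
    push Not at hc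
    exact hcon (layer_lemma H L par v LH hdis L0 (fun i w hw => hpar w i hw) hℓ hi hc)
  have cnL : ∀ i I, I ⊆ L (i+1) → cn G H I ⊆ L i ∪ L (i+1) ∪ L (i+2) := by
    intro i I hI w hw
    simp only [cn, mem_filter] at hw
    rcases hw with ⟨hwH, h | ⟨u, hu, huw⟩⟩
    · simp [hI h]
    · have hu' := hI hu
      have h1 := ball_adj (Lball _ hu') hwH huw
      have := hcov _ h1
      simp only [mem_biUnion, mem_range] at this
      obtain ⟨j, hj, hwj⟩ := this
      have : i ≤ j := by
        by_contra hlt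
        have := ball_adj (Lball j hwj) (LH _ hu') huw.symm
        exact Lnot (j+1) (i+1) u (by omega) hu' this
      have : j = i ∨ j = i + 1 ∨ j = i + 2 := by omega
      simp only [mem_union]
      rcases this with rfl | rfl | rfl
      · exact Or.inl (Or.inl hwj)
      · exact Or.inl (Or.inr hwj)
      · exact Or.inr hwj
  have grow : ∀ i, 2 * (i+1) + 1 ≤ ℓ →
      4 * ((L (i+1)).card : ℝ) ≤ (L i).card + (L (i+1)).card + (L (i+2)).card := by
    intro i hi
    obtain ⟨I, hI1, hI2, hI3⟩ := exists_ind G (L (i+1))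
    have h1 := hcn (hI1.trans (LH _)) hI2
    have h2 : ((cn G H I).card : ℝ) ≤ (L i).card + (L (i+1)).card + (L (i+2)).card := by
      have := (card_le_card (cnL i I hI1)).trans ((card_union_le _ _).trans
        (Nat.add_le_add_right (card_union_le _ _) _))
      exact_mod_cast this
    have h3 : ((L (i+1)).card : ℝ) ≤ ((ℓ - 2 : ℕ) : ℝ) * al G (L (i+1)) := by
      exact_mod_cast layer (i+1) hi
    have h4 : 4 * ((ℓ - 2 : ℕ) : ℝ) ≤ D := by
      have : (2:ℝ) * ((ℓ - 2 : ℕ) : ℝ) ≤ k := by exact_mod_cast hℓk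
      linarith
    rw [hI3] at h1
    have h5 : 4 * ((ℓ - 2 : ℕ) : ℝ) * al G (L (i+1)) ≤ D * al G (L (i+1)) :=
      mul_le_mul_of_nonneg_right h4 (Nat.cast_nonneg _)
    linarith
  have base : D - 1 ≤ (L 1).card := by
    have h1 := hcn (I := {v}) (by simpa using hv) (ind_singleton v)
    have h2 : cn G H {v} ⊆ L 0 ∪ L 1 := by
      intro w hw
      simp only [cn, mem_filter, mem_singleton, exists_eq_left] at hw
      have hw1 : w ∈ ball G H v 1 := by
        rw [mem_ball_succ, mem_ball_zero]
        exact ⟨hw.1, hw.2.imp id fun h => ⟨v, by simp [ball], h⟩⟩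
      by_cases h : w = v
      · simp [L0, h]
      · rw [mem_union]; right
        rw [show (1:ℕ) = 0 + 1 from rfl, LS 0, mem_sdiff, mem_ball_zero]
        exact ⟨hw1, h⟩
    have h3 : ((cn G H {v}).card : ℝ) ≤ 1 + (L 1).card := by
      have := (card_le_card h2).trans (card_union_le _ _)
      rw [L0, card_singleton] at this
      exact_mod_cast this
    simp at h1
    linarith
  have main : ∀ i, 2 * (i+1) + 1 ≤ ℓ → ((L i).card : ℝ) ≤ (L (i+1)).card ∧
      (2:ℝ)^i * (D - 1) ≤ (L (i+1)).card := by
    intro i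
    induction i with
    | zero =>
      intro _
      refine ⟨?_, by simpa using base⟩
      rw [L0, card_singleton]
      simp only [Nat.cast_one, zero_add]
      have : (1:ℝ) ≤ k := by
        have : 1 ≤ k := by omega
        exact_mod_cast this
      linarith
    | succ i ih =>
      intro hi
      obtain ⟨a, b⟩ := ih (by omega)
      have := grow i (by omega)
      refine ⟨?_, ?_⟩
      · have h0 : (0:ℝ) ≤ (L (i+1)).card := Nat.cast_nonneg _
        show ((L (i+1)).card : ℝ) ≤ (L (i+2)).card
        linarith
      · show (2:ℝ)^(i+1) * (D-1) ≤ (L (i+2)).card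
        rw [pow_succ]
        linarith
  obtain ⟨x, hx⟩ : ∃ x, 2 * (x + 1) + 1 ≤ ℓ ∧ ℓ - 2 ≤ 2 * (x+1) := ⟨(ℓ - 1)/2 - 1, by omega⟩
  obtain ⟨_, h1⟩ := main x hx.1
  have h2 := layer (x+1) hx.1
  have h3 : al G (L (x+1)) ≤ k := (al_mono ((LH _).trans hHU)).trans hk
  have h4 : ((L (x+1)).card : ℝ) ≤ (2 * (x+1)) * k := by
    have := h2.trans (Nat.mul_le_mul hx.2 h3)
    exact_mod_cast this
  have h5 : ((x:ℝ) + 1) ≤ 2^x := by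
    have := Nat.lt_two_pow_self (n := x)
    exact_mod_cast this
  have h6 : ((x:ℝ) + 1) * (D - 1) ≤ 2^x * (D-1) := mul_le_mul_of_nonneg_right h5 (by linarith)
  have h7 : ((x:ℝ) + 1) * (2 * k) < (x+1) * (D - 1) :=
    mul_lt_mul_of_pos_left (by linarith) (by positivity)
  linarith

end CycP

open SimpleGraph Finset
namespace CycP
open scoped Classical

noncomputable def nb {V : Type} (G : SimpleGraph V) (S : Finset V) (q : V) : Finset V :=
  S.filter fun v => G.Adj q v

theorem mem_nb {V : Type} {G : SimpleGraph V} {S : Finset V} {q v : V} :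
    v ∈ nb G S q ↔ v ∈ S ∧ G.Adj q v := by simp [nb]

theorem flex {V : Type} {G : SimpleGraph V} {H Y : Finset V} {Dg : ℕ}
    (hdeg : ∀ q ∈ H, Dg ≤ (nb G H q).card) {q0 : V} (hq0 : q0 ∈ H) (hq0Y : q0 ∉ Y) :
    ∀ s : ℕ, al G H + 2 * s + Y.card < Dg → ∃ F q, F ⊆ H ∧ q0 ∈ F ∧ q ∈ F ∧ Disjoint F Y ∧
      F.card ≤ 2 * s + 1 ∧ ∀ e, s + 1 ≤ e → e ≤ 2 * s + 1 → PV G F q0 q e := by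
  intro s
  induction s with
  | zero =>
    intro _
    refine ⟨{q0}, q0, by simpa using hq0, by simp, by simp, by simpa using hq0Y, by simp, ?_⟩
    intro e h1 h2
    obtain rfl : e = 1 := by omega
    exact PV.single (by simp)
  | succ s ih =>
    intro hs
    obtain ⟨F, q, hF, hq0F, hqF, hFY, hFc, hP⟩ := ih (by omega)
    have hN : al G ((nb G H q \ F) \ Y) < ((nb G H q \ F) \ Y).card := by
      have h1 := hdeg q (hF hqF)
      have h2 := le_card_sdiff F (nb G H q)
      have h3 := le_card_sdiff Y (nb G H q \ F)
      have h4 : al G ((nb G H q \ F) \ Y) ≤ al G H :=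
        al_mono ((sdiff_subset.trans sdiff_subset).trans (filter_subset _ _))
      omega
    obtain ⟨z1, hz1, z2, hz2, hz⟩ := exists_edge hN
    simp only [mem_sdiff, mem_nb] at hz1 hz2
    obtain ⟨⟨⟨z1H, z1q⟩, z1F⟩, z1Y⟩ := hz1
    obtain ⟨⟨⟨z2H, z2q⟩, z2F⟩, z2Y⟩ := hz2
    refine ⟨F ∪ {z1, z2}, z2, ?_, by simp [hq0F], by simp, ?_, ?_, ?_⟩
    · apply union_subset hF
      intro z; simp only [mem_insert, mem_singleton]; rintro (rfl | rfl) <;> assumption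
    · rw [disjoint_union_left]
      refine ⟨hFY, ?_⟩
      simp [z1Y, z2Y]
    · have := card_union_le F {z1, z2}
      have h2 := card_le_two (a := z1) (b := z2)
      omega
    · intro e h1 h2
      rcases Nat.lt_or_ge (2*s+2) e with h | h
      · obtain rfl : e = (2 * s + 1) + 1 + 1 := by omega
        have p1 := (hP (2*s+1) (by omega) le_rfl).append (PV.single (mem_singleton_self z1))
          (by simpa using z1F) z1q
        have p2 := p1.append (PV.single (mem_singleton_self z2))
          (by simp [z2F, hz.ne']) hz
        refine p2.mono ?_
        intro z; simp only [mem_union, mem_insert, mem_singleton]; tauto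
      · obtain ⟨e, rfl⟩ : ∃ e', e = e' + 1 := ⟨e - 1, by omega⟩
        have p1 := (hP e (by omega) (by omega)).append (PV.single (mem_singleton_self z2))
          (by simpa using z2F) z2q
        refine p1.mono ?_
        intro z; simp only [mem_union, mem_insert, mem_singleton]; tauto

theorem ce_insert {V : Type} {G : SimpleGraph V} {S : Finset V} {l1 l3 p : List V}
    (h : Pth G S (l1 ++ l3)) (hp : Pth G S p) (hd : ∀ x ∈ p, x ∉ l1 ++ l3) (hne : p ≠ [])
    (h1 : ∀ a ∈ l1.getLast?, ∀ b ∈ p.head?, G.Adj a b)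
    (h2 : ∀ a ∈ p.getLast?, ∀ b ∈ l3.head?, G.Adj a b) : Pth G S (l1 ++ (p ++ l3)) := by
  have hperm : (l1 ++ (p ++ l3)).Perm (p ++ (l1 ++ l3)) := by
    rw [← List.append_assoc, ← List.append_assoc]
    exact List.Perm.append_right _ List.perm_append_comm
  have hc := List.isChain_append.1 h.ch
  refine ⟨?_, ?_, ?_⟩
  · rw [List.isChain_append, List.isChain_append]
    refine ⟨hc.1, ⟨hp.ch, hc.2.1, h2⟩, ?_⟩
    intro a ha b hb
    rw [List.head?_append_of_ne_nil _ hne] at hb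
    exact h1 a ha b hb
  · rw [hperm.nodup_iff, List.nodup_append]
    refine ⟨hp.nd, h.nd, ?_⟩
    rintro a ha b hb rfl
    exact hd a ha hb
  · intro x hx
    rw [hperm.mem_iff, List.mem_append] at hx
    exact hx.elim (hp.sub x) (h.sub x)

theorem ce_rotate {V : Type} {G : SimpleGraph V} {S : Finset V} {l1 mid l3 p : List V}
    (h : Pth G S (l1 ++ (mid ++ l3))) (hp : Pth G S p) (hd : ∀ x ∈ p, x ∉ l1 ++ (mid ++ l3))
    (hne : p ≠ []) (hm : mid ≠ [])
    (h1 : ∀ a ∈ l1.getLast?, ∀ b ∈ p.head?, G.Adj a b)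
    (h2 : ∀ a ∈ p.getLast?, ∀ b ∈ mid.getLast?, G.Adj a b)
    (h3 : ∀ a ∈ mid.head?, ∀ b ∈ l3.head?, G.Adj a b) :
    Pth G S (l1 ++ (p ++ (mid.reverse ++ l3))) := by
  have hc := List.isChain_append.1 h.ch
  have hc2 := List.isChain_append.1 hc.2.1
  have hperm : (l1 ++ (p ++ (mid.reverse ++ l3))).Perm (p ++ (l1 ++ (mid ++ l3))) := by
    have e1 : (l1 ++ (p ++ (mid.reverse ++ l3))).Perm (l1 ++ (p ++ (mid ++ l3))) :=
      ((List.Perm.append_right _ (List.reverse_perm mid)).append_left _).append_left _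
    refine e1.trans ?_
    rw [← List.append_assoc, ← List.append_assoc p]
    exact List.Perm.append_right _ List.perm_append_comm
  refine ⟨?_, ?_, ?_⟩
  · rw [List.isChain_append, List.isChain_append, List.isChain_append]
    refine ⟨hc.1, ⟨hp.ch, ⟨?_, hc2.2.1, ?_⟩, ?_⟩, ?_⟩
    · rw [List.isChain_reverse]
      exact hc2.1.imp fun a b hab => hab.symm
    · intro a ha b hb
      rw [List.getLast?_reverse] at ha
      exact h3 a ha b hb
    · intro a ha b hb
      rw [List.head?_append_of_ne_nil _ (by simpa using hm), List.head?_reverse] at hb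
      exact h2 a ha b hb
    · intro a ha b hb
      rw [List.head?_append_of_ne_nil _ hne] at hb
      exact h1 a ha b hb
  · rw [hperm.nodup_iff, List.nodup_append]
    refine ⟨hp.nd, h.nd, ?_⟩
    rintro a ha b hb rfl
    exact hd a ha hb
  · intro x hx
    rw [hperm.mem_iff, List.mem_append] at hx
    exact hx.elim (hp.sub x) (h.sub x)

theorem exists_longest {P : ℕ → Prop} {N m : ℕ} (hm : P m) (hN : ∀ j, P j → j ≤ N) :
    ∃ n, P n ∧ ∀ j, P j → j ≤ n := by
  refine ⟨Nat.findGreatest P N, Nat.findGreatest_spec (hN m hm) hm, fun j hj => ?_⟩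
  exact Nat.le_findGreatest (hN j hj) hj

theorem Pth.length_le {V : Type} {G : SimpleGraph V} {S : Finset V} {l : List V} (h : Pth G S l) :
    l.length ≤ S.card := by
  rw [← List.toFinset_card_of_nodup h.nd]
  apply card_le_card
  intro x hx
  exact h.sub x (by simpa using hx)

/-- Chvatal--Erdos: Hamilton path between two given vertices. -/
theorem chvatal_erdos {V : Type} {G : SimpleGraph V} {S : Finset V} {x y : V} {t : ℕ}
    (hx : x ∈ S) (hy : y ∈ S) (hxy : x ≠ y) (ht : al G S + 1 ≤ t)
    (hconn : ∀ F, F.card ≤ t → ∀ u ∈ S \ F, ∀ v ∈ S \ F, v ∈ Reach G (S \ F) u) :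
    PV G S x y S.card := by
  have h0 : ∃ m, PV G S x y m := by
    have hh := hconn ∅ (by simp) x (by simpa using hx) y (by simpa using hy)
    obtain ⟨m, hm⟩ := reach_path (by simpa using hx) hh
    exact ⟨m, hm.mono (reach_subset.trans sdiff_subset)⟩
  obtain ⟨m, hm⟩ := h0
  obtain ⟨n, hn, hmax⟩ := exists_longest (P := PV G S x y) (N := S.card) hm (by
    rintro j ⟨l, h1, _, _, rfl⟩; exact h1.length_le)
  obtain ⟨l, hl, hlx, hly, hln⟩ := hn
  have hmaxl : ∀ l' : List V, Pth G S l' → l'.head? = some x → l'.getLast? = some y →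
      l'.length ≤ l.length := fun l' a b c => by rw [hln]; exact hmax _ ⟨l', a, b, c, rfl⟩
  by_cases hcov : ∀ d ∈ S, d ∈ l
  · have : l.length = S.card := by
      apply le_antisymm hl.length_le
      rw [← List.toFinset_card_of_nodup hl.nd]
      exact card_le_card fun d hd => by simpa using hcov d hd
    exact ⟨l, hl, hlx, hly, this⟩
  exfalso
  push Not at hcov
  obtain ⟨d, hdS, hdl⟩ := hcov
  set W := l.toFinset with hW
  have hdSW : d ∈ S \ W := by simp [hdS, hdl, hW]
  set D := Reach G (S \ W) d with hD
  let A := W.filter fun a => ∃ u ∈ D, G.Adj a u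
  have hAl : ∀ a ∈ A, ∃ u ∈ D, G.Adj a u := fun a ha => (mem_filter.1 ha).2
  -- connecting paths through D
  have hpath : ∀ a ∈ A, ∀ b ∈ A, ∃ p : List V, Pth G S p ∧ (∀ z ∈ p, z ∉ l) ∧ p ≠ [] ∧
      (∀ z ∈ p.head?, G.Adj a z) ∧ (∀ z ∈ p.getLast?, G.Adj z b) := by
    intro a ha b hb
    obtain ⟨u, hu, hau⟩ := hAl a ha
    obtain ⟨w, hw, hbw⟩ := hAl b hb
    have huS := reach_subset hu
    obtain ⟨m, p, h1, h2, h3, h4⟩ := reach_path huS (reach_trans huS (reach_symm hdSW hu) hw)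
    refine ⟨p, h1.mono (reach_subset.trans sdiff_subset), ?_, ?_, ?_, ?_⟩
    · intro z hz hzl
      have := reach_subset (h1.sub z hz)
      simp [hW, hzl] at this
    · rintro rfl; simp at h2
    · rw [h2]; simpa using hau
    · rw [h3]; simpa using hbw.symm
  -- consecutive
  have hcons : ∀ i (h : i + 1 < l.length), ¬ (l[i] ∈ A ∧ l[i+1] ∈ A) := by
    rintro i hi ⟨ha, hb⟩
    obtain ⟨p, p1, p2, p3, p4, p5⟩ := hpath _ ha _ hb
    have hsplit : l.take (i+1) ++ l.drop (i+1) = l := List.take_append_drop _ _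
    have hP : Pth G S (l.take (i+1) ++ (p ++ l.drop (i+1))) := by
      apply ce_insert (by rwa [hsplit]) p1 (by rwa [hsplit]) p3
      · intro a ha'
        rw [List.getLast?_take, if_neg (by omega), Nat.add_sub_cancel,
          List.getElem?_eq_getElem (by omega)] at ha'
        simp at ha'
        rw [← ha']; exact p4
      · intro a ha' b hb'
        rw [List.head?_drop, List.getElem?_eq_getElem (by omega)] at hb'
        simp at hb'
        rw [← hb']; exact p5 a ha'
    have := hmaxl _ hP (by rw [List.head?_append, List.head?_take, hlx]; simp)
      (by
        rw [List.getLast?_append, List.getLast?_append, List.getLast?_drop, hly,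
          if_neg (by omega)]; rfl)
    have hpl := List.length_pos_of_ne_nil p3
    simp at this
    omega
  have hrot : ∀ i j (hij : i < j) (h : j + 1 < l.length), l[i] ∈ A → l[j] ∈ A →
      ¬ G.Adj l[i+1] l[j+1] := by
    intro i j hij hj ha hb hadj
    obtain ⟨p, p1, p2, p3, p4, p5⟩ := hpath _ ha _ hb
    set mid := (l.take (j+1)).drop (i+1) with hmid
    have hsplit : l.take (i+1) ++ (mid ++ l.drop (j+1)) = l := by
      rw [← List.append_assoc, hmid]
      have : List.take (i+1) l = List.take (i+1) (List.take (j+1) l) := by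
        rw [List.take_take, min_eq_left (by omega)]
      rw [this, List.take_append_drop, List.take_append_drop]
    have hml : mid.length = j - i := by simp [hmid]; omega
    have hmne : mid ≠ [] := by intro h; rw [h] at hml; simp at hml; omega
    have hP : Pth G S (l.take (i+1) ++ (p ++ (mid.reverse ++ l.drop (j+1)))) := by
      apply ce_rotate (by rwa [hsplit]) p1 (by rwa [hsplit]) p3 hmne
      · intro a ha'
        rw [List.getLast?_take, if_neg (by omega), Nat.add_sub_cancel,
          List.getElem?_eq_getElem (by omega)] at ha'
        simp at ha'
        rw [← ha']; exact p4
      · intro a ha' b hb'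
        rw [hmid, List.getLast?_drop, if_neg (by simp; omega), List.getLast?_take,
          if_neg (by omega), Nat.add_sub_cancel, List.getElem?_eq_getElem (by omega)] at hb'
        simp at hb'
        rw [← hb']; exact p5 a ha'
      · intro a ha' b hb'
        rw [hmid, List.head?_drop, List.getElem?_take_of_lt (by omega),
          List.getElem?_eq_getElem (by omega)] at ha'
        rw [List.head?_drop, List.getElem?_eq_getElem (by omega)] at hb'
        simp at ha' hb'
        rw [← ha', ← hb']; exact hadj
    have := hmaxl _ hP (by rw [List.head?_append, List.head?_take, hlx]; simp)
      (by
        rw [List.getLast?_append, List.getLast?_append, List.getLast?_append, List.getLast?_drop,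
          hly, if_neg (by omega)]; rfl)
    have hpl := List.length_pos_of_ne_nil p3
    simp [hml] at this
    omega
  -- A is large
  have hlen : 2 ≤ l.length := by
    rcases l with _ | ⟨a, _ | ⟨b, l⟩⟩
    · simp at hlx
    · simp at hlx hly; exact absurd (hlx.symm.trans hly) hxy
    · simp
  have hAW : ∃ w ∈ W, w ∉ A := by
    have := hcons 0 (by omega)
    by_cases h : l[0] ∈ A
    · exact ⟨l[0+1], by simp [hW], fun h' => this ⟨h, h'⟩⟩
    · exact ⟨l[0], by simp [hW], h⟩
  have hAbig : t < A.card := by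
    by_contra hc
    push Not at hc
    obtain ⟨w, hwW, hwA⟩ := hAW
    have hwl : w ∈ l := by simpa [hW] using hwW
    have hAsub : A ⊆ W := filter_subset _ _
    have hr := hconn A hc d (mem_sdiff.2 ⟨hdS, fun h => hdl (by simpa [hW] using hAsub h)⟩)
      w (mem_sdiff.2 ⟨hl.sub w hwl, hwA⟩)
    obtain ⟨_, j, hj⟩ := mem_reach.1 hr
    have : ∀ j z, z ∈ ball G (S \ A) d j → z ∈ D := by
      intro j
      induction j with
      | zero => intro z hz; rw [mem_ball_zero] at hz; rw [hz]; exact self_mem_reach hdSW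
      | succ j ih =>
        intro z hz
        rcases mem_ball_succ.1 hz with ⟨h1, h2 | ⟨u, h2, h3⟩⟩
        · exact ih z h2
        · have hu := ih u h2
          rw [mem_sdiff] at h1
          have hzW : z ∉ W := fun hzW => h1.2 (mem_filter.2 ⟨hzW, u, hu, h3.symm⟩)
          exact reach_adj hu (mem_sdiff.2 ⟨h1.1, hzW⟩) h3
    have hwD := reach_subset (this j w hj)
    simp [hwW] at hwD
  -- independent successors
  let g : ℕ → V := fun i => l.getD i x
  have hg : ∀ i (h : i < l.length), g i = l[i] := fun i h => by simp [g, h]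
  let IA := (Finset.range l.length).filter fun i => g i ∈ A
  have hIAc : A.card ≤ IA.card := by
    have : A ⊆ IA.image g := by
      intro a ha
      have haW : a ∈ l := by simpa [hW] using (mem_filter.1 ha).1
      obtain ⟨i, hi, rfl⟩ := List.getElem_of_mem haW
      refine mem_image.2 ⟨i, ?_, hg i hi⟩
      simp only [IA, mem_filter, mem_range]
      exact ⟨hi, by rw [hg i hi]; exact ha⟩
    exact (card_le_card this).trans card_image_le
  let J := IA.erase (l.length - 1)
  have hJc : IA.card - 1 ≤ J.card := pred_card_le_card_erase
  have hJ : ∀ i ∈ J, ∃ h : i + 1 < l.length, l[i] ∈ A := by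
    intro i hi
    simp only [J, IA, mem_erase, mem_filter, mem_range] at hi
    obtain ⟨h1, h2, h3⟩ := hi
    rw [hg i h2] at h3
    exact ⟨by omega, h3⟩
  have hinj : ∀ i j (hi : i < l.length) (hj : j < l.length), l[i] = l[j] → i = j := by
    intro i j hi hj e
    exact (List.Nodup.getElem_inj_iff hl.nd).1 e
  have hcI : (J.image fun i => g (i+1)).card = J.card := by
    apply card_image_of_injOn
    intro i hi j hj e
    obtain ⟨hi1, _⟩ := hJ i hi
    obtain ⟨hj1, _⟩ := hJ j hj
    simp only [hg (i+1) hi1, hg (j+1) hj1] at e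
    have := hinj _ _ _ _ e
    omega
  have hind : Ind G (J.image fun i => g (i+1)) := by
    intro a ha b hb hab hadj
    obtain ⟨i, hi, rfl⟩ := mem_image.1 ha
    obtain ⟨j, hj, rfl⟩ := mem_image.1 hb
    obtain ⟨hi1, hi2⟩ := hJ i hi
    obtain ⟨hj1, hj2⟩ := hJ j hj
    simp only [hg (i+1) hi1, hg (j+1) hj1] at hadj
    rcases Nat.lt_trichotomy i j with h | h | h
    · exact hrot i j h hj1 hi2 hj2 hadj
    · subst h; exact hab rfl
    · exact hrot j i h hi1 hj2 hi2 hadj.symm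
  have hsub : (J.image fun i => g (i+1)) ⊆ S := by
    intro a ha
    obtain ⟨i, hi, rfl⟩ := mem_image.1 ha
    obtain ⟨hi1, hi2⟩ := hJ i hi
    simp only [hg (i+1) hi1]
    exact hl.sub _ (List.getElem_mem _)
  have := card_le_al hsub hind
  omega

end CycP

open SimpleGraph Finset
namespace CycP
open scoped Classical

theorem sqrt_sub_le (a b : ℕ) (h : a ≤ b) : √(b:ℝ) - √(a:ℝ) ≤ (b:ℝ) - a := by
  rcases h.eq_or_lt with rfl | h
  · simp
  · have hb : (1:ℝ) ≤ √(b:ℝ) := by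
      rw [Real.one_le_sqrt]
      have : 1 ≤ b := by omega
      exact_mod_cast this
    have h1 := Real.sq_sqrt (Nat.cast_nonneg (α := ℝ) a)
    have h2 := Real.sq_sqrt (Nat.cast_nonneg (α := ℝ) b)
    have h3 : √(a:ℝ) ≤ √(b:ℝ) := Real.sqrt_le_sqrt (by exact_mod_cast h.le)
    have h4 := Real.sqrt_nonneg (a:ℝ)
    nlinarith

theorem sqrt_add_aux' (a b : ℝ) (ha : 0 ≤ a) (hab : a ≤ b) :
    √(a + b) + √a / 2 ≤ √a + √b := by
  have h1 := Real.sq_sqrt ha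
  have h2 := Real.sq_sqrt (ha.trans hab)
  have h3 : √a ≤ √b := Real.sqrt_le_sqrt hab
  have h4 := Real.sqrt_nonneg a
  have : √(a+b) ≤ √b + √a/2 := by
    apply Real.sqrt_le_iff.2
    constructor
    · linarith
    · nlinarith
  linarith

theorem sqrt_add_aux (a b m : ℝ) (hm : 0 ≤ m) (ha : m ≤ a) (hb : m ≤ b) :
    √(a + b) + √m / 2 ≤ √a + √b := by
  rcases le_total a b with h | h
  · have := sqrt_add_aux' a b (hm.trans ha) h
    have h2 := Real.sqrt_le_sqrt ha
    linarith
  · have := sqrt_add_aux' b a (hm.trans hb) h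
    have h2 := Real.sqrt_le_sqrt hb
    rw [add_comm b a] at this
    linarith

structure Cor {V : Type} (G : SimpleGraph V) (H : Finset V) (lam K : ℝ) : Prop where
  ne : H.Nonempty
  big : lam * al G H - K * √(al G H : ℝ) ≤ H.card
  min : ∀ U', U' ⊂ H → U'.Nonempty → (U'.card : ℝ) < lam * al G U' - K * √(al G U' : ℝ)
  hK : 0 < K
  hKl : K ≤ lam / 4

theorem exists_cor {V : Type} {G : SimpleGraph V} {U : Finset V} {lam K : ℝ} (hU : U.Nonempty)
    (h : lam * al G U - K * √(al G U : ℝ) ≤ U.card) (hK : 0 < K) (hKl : K ≤ lam / 4) :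
    ∃ H, H ⊆ U ∧ Cor G H lam K := by
  obtain ⟨H, h1, h2, h3, h4⟩ := exists_min_f G (fun a => lam * a - K * √(a:ℝ)) hU h
  exact ⟨H, h1, h2, h3, h4, hK, hKl⟩

namespace Cor
variable {V : Type} {G : SimpleGraph V} {H : Finset V} {lam K : ℝ}

theorem fmono (hc : Cor G H lam K) {a b : ℕ} (h : a ≤ b) :
    lam * a - K * √(a:ℝ) + (lam - K) * ((b:ℝ) - a) ≤ lam * b - K * √(b:ℝ) := by
  have h1 := sqrt_sub_le a b h
  have h2 := mul_le_mul_of_nonneg_left h1 hc.hK.le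
  linarith

theorem lam_pos (hc : Cor G H lam K) : 0 < lam := by have := hc.hK; have := hc.hKl; linarith

theorem fmono' (hc : Cor G H lam K) {a b : ℕ} (h : a ≤ b) :
    lam * a - K * √(a:ℝ) ≤ lam * b - K * √(b:ℝ) := by
  have h1 := hc.fmono h
  have h2 : (0:ℝ) ≤ (b:ℝ) - a := by
    have : (a:ℝ) ≤ b := by exact_mod_cast h
    linarith
  have h3 : 0 ≤ lam - K := by have := hc.hKl; have := hc.lam_pos; linarith
  have := mul_nonneg h3 h2
  linarith

theorem sep (hc : Cor G H lam K) {A B F : Finset V} {m : ℕ} (hA : A ⊆ H) (hB : B ⊆ H)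
    (hm : 1 ≤ m) (hAm : m ≤ al G A) (hBm : m ≤ al G B) (hs : Sep G A B) (hF : H ⊆ A ∪ B ∪ F) :
    K / 2 * √(m:ℝ) < F.card := by
  have neOf : ∀ X : Finset V, m ≤ al G X → X.Nonempty := by
    intro X hX
    by_contra h
    rw [not_nonempty_iff_eq_empty] at h
    rw [h, al_empty] at hX
    omega
  have hAn := neOf A hAm
  have hBn := neOf B hBm
  have hA1 : A ⊂ H := by
    refine ⟨hA, fun h => ?_⟩
    obtain ⟨b, hb⟩ := hBn
    exact Finset.disjoint_left.1 hs.1 (h (hB hb)) hb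
  have hB1 : B ⊂ H := by
    refine ⟨hB, fun h => ?_⟩
    obtain ⟨b, hb⟩ := hAn
    exact Finset.disjoint_left.1 hs.1 hb (h (hA hb))
  have h1 := hc.min A hA1 hAn
  have h2 := hc.min B hB1 hBn
  have h3 : (H.card : ℝ) ≤ A.card + B.card + F.card := by
    have := (card_le_card hF).trans ((card_union_le _ _).trans
      (Nat.add_le_add_right (card_union_le _ _) _))
    exact_mod_cast this
  have h4 : al G A + al G B ≤ al G H := (al_union_ge hs).trans (al_mono (union_subset hA hB))
  have h5 := hc.fmono' h4
  have h6 := sqrt_add_aux (al G A) (al G B) m (Nat.cast_nonneg _) (by exact_mod_cast hAm)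
    (by exact_mod_cast hBm)
  have h7 := mul_le_mul_of_nonneg_left h6 hc.hK.le
  have h8 := hc.big
  push_cast at h5
  linarith

theorem conn (hc : Cor G H lam K) {F : Finset V} (hF : (F.card : ℝ) ≤ K / 2) {x y : V}
    (hx : x ∈ H \ F) (hy : y ∈ H \ F) : y ∈ Reach G (H \ F) x := by
  by_contra hn
  have h1 : y ∈ (H \ F) \ Reach G (H \ F) x := mem_sdiff.2 ⟨hy, hn⟩
  have := hc.sep (A := Reach G (H \ F) x) (B := (H \ F) \ Reach G (H \ F) x) (F := F) (m := 1)
    (reach_subset.trans sdiff_subset) (sdiff_subset.trans sdiff_subset) le_rfl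
    (one_le_al ⟨x, self_mem_reach hx⟩) (one_le_al ⟨y, h1⟩) reach_sep (by
      intro z hz
      simp only [mem_union, mem_sdiff]
      tauto)
  simp at this
  linarith

theorem deg (hc : Cor G H lam K) {v : V} (hv : v ∈ H) : lam - K - 1 ≤ ((nb G H v).card : ℝ) := by
  have hsub : cn G H {v} ⊆ H := filter_subset _ _
  have hcc : ((H \ cn G H {v}).card : ℝ) + (cn G H {v}).card = H.card := by
    exact_mod_cast card_sdiff_add_card_eq_card hsub
  have hvc : v ∈ cn G H {v} := by simp [cn, hv]
  have hle : ((cn G H {v}).card : ℝ) ≤ 1 + (nb G H v).card := by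
    have : cn G H {v} ⊆ {v} ∪ nb G H v := by
      intro w hw
      simp only [cn, mem_filter, mem_singleton, exists_eq_left] at hw
      simp only [mem_union, mem_singleton, mem_nb]
      tauto
    have := (card_le_card this).trans (card_union_le _ _)
    rw [card_singleton] at this
    exact_mod_cast this
  have hal := al_sdiff_cn (G := G) (U := H) (I := {v}) (by simpa using hv) (ind_singleton v)
  rw [card_singleton] at hal
  have key : ((H \ cn G H {v}).card : ℝ) ≤ lam * ((al G H - 1 : ℕ):ℝ)
      - K * √((al G H - 1 : ℕ):ℝ) := by
    rcases (H \ cn G H {v}).eq_empty_or_nonempty with h | h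
    · rw [h]
      have := hc.fmono' (Nat.zero_le (al G H - 1))
      simpa using this
    · have h1 := hc.min _ ⟨sdiff_subset, fun h' => by
        have := h' hv
        simp [hvc] at this⟩ h
      have h2 := hc.fmono' (show al G (H \ cn G H {v}) ≤ al G H - 1 by omega)
      linarith
  have h3 := hc.fmono (show al G H - 1 ≤ al G H by omega)
  have h4 : (al G H : ℝ) - ((al G H - 1 : ℕ):ℝ) = 1 := by
    rw [Nat.cast_sub (by omega)]; simp
  rw [h4] at h3
  have := hc.big
  linarith

theorem size (hc : Cor G H lam K) {U : Finset V} (hU : U ⊂ H) : (U.card : ℝ) ≤ lam * al G U := by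
  rcases U.eq_empty_or_nonempty with h | h
  · rw [h]; simp [al_empty]
  · have := hc.min U hU h
    have h2 : 0 ≤ K * √(al G U : ℝ) := mul_nonneg hc.hK.le (Real.sqrt_nonneg _)
    linarith

theorem card_ge (hc : Cor G H lam K) : (lam - K) * al G H ≤ H.card := by
  have := hc.fmono (Nat.zero_le (al G H))
  have h2 := hc.big
  simp at this
  linarith

/-- degrees as naturals -/
theorem degN (hc : Cor G H lam K) {n : ℕ} (hn : (n : ℝ) ≤ lam - K - 1) :
    ∀ q ∈ H, n ≤ (nb G H q).card := by
  intro q hq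
  have := hc.deg hq
  have : (n:ℝ) ≤ (nb G H q).card := by linarith
  exact_mod_cast this

theorem core_small (hc : Cor G H lam K) {ℓ : ℕ} (h2 : 2 ≤ al G H)
    (hh : 5 * (al G H : ℝ) + 2 ≤ K / 2) (hℓ1 : K ≤ ℓ) (hℓ2 : (ℓ:ℝ) ≤ lam) :
    HasCycleLength G ℓ := by
  set h := al G H with hh0
  have hKl := hc.hKl
  have hK := hc.hK
  have h2' : (2:ℝ) ≤ h := by exact_mod_cast h2
  obtain ⟨q0, hq0⟩ := hc.ne
  have hdeg := hc.degN (n := 5 * h + 2) (by push_cast; linarith)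
  obtain ⟨F, q, hF, hq0F, hqF, -, hFc, hP⟩ := flex (Y := ∅) hdeg hq0 (by simp) (2 * h) (by
    simp; omega)
  have nbr : ∀ w ∈ H, ∀ X : Finset V, X.card ≤ 5 * h + 1 → ∃ z ∈ H, G.Adj w z ∧ z ∉ X := by
    intro w hw X hX
    have h1 := hdeg w hw
    have h3 := le_card_sdiff X (nb G H w)
    obtain ⟨z, hz⟩ := card_pos.1 (show 0 < (nb G H w \ X).card by omega)
    rw [mem_sdiff, mem_nb] at hz
    exact ⟨z, hz.1.1, hz.1.2, hz.2⟩
  obtain ⟨x, hxH, hqx, hxF⟩ := nbr q (hF hqF) F (by omega)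
  obtain ⟨y, hyH, hqy, hyF⟩ := nbr q0 hq0 (insert x F) (by
    have := card_insert_le x F
    omega)
  simp only [mem_insert, not_or] at hyF
  have hce := chvatal_erdos (G := G) (S := H \ F) (x := x) (y := y) (t := h + 1)
    (mem_sdiff.2 ⟨hxH, hxF⟩) (mem_sdiff.2 ⟨hyH, hyF.2⟩) (Ne.symm hyF.1)
    (Nat.add_le_add_right (al_mono sdiff_subset) 1) (by
      intro F' hF' u hu v hv
      rw [sdiff_sdiff_left, sup_eq_union] at hu hv ⊢
      refine hc.conn ?_ hu hv
      have : ((F ∪ F').card : ℝ) ≤ 5 * h + 2 := by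
        have := card_union_le F F'
        exact_mod_cast (show (F ∪ F').card ≤ 5 * h + 2 by omega)
      linarith)
  have hSc : ℓ ≤ (H \ F).card := by
    have h3 := le_card_sdiff F H
    have h4 := hc.card_ge
    have h5 : (lam - K) * 2 ≤ (lam - K) * h := mul_le_mul_of_nonneg_left h2' (by linarith)
    have h6 : ((F.card : ℕ):ℝ) ≤ 4 * h + 1 := by
      exact_mod_cast (show F.card ≤ 4 * h + 1 by omega)
    have h7 : (H.card : ℝ) ≤ (H \ F).card + F.card := by
      exact_mod_cast (show H.card ≤ (H \ F).card + F.card by omega)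
    have : (ℓ:ℝ) ≤ (H \ F).card := by linarith
    exact_mod_cast this
  have hℓh : 10 * h + 4 ≤ ℓ := by
    have : 10 * (h:ℝ) + 4 ≤ ℓ := by linarith
    exact_mod_cast this
  obtain ⟨L, hL1, hL2, hL3⟩ := hce.hit (k := h) (T := ℓ - (2 * h + 1)) (al_mono sdiff_subset)
    (by omega) (by omega)
  have p := (hP (ℓ - L) (by omega) (by omega)).append hL3 disjoint_sdiff hqx
  rw [Nat.sub_add_cancel (by omega)] at p
  exact p.cycle hqy.symm (by omega)

end Cor

theorem reach_closed {V : Type} {G : SimpleGraph V} {S A : Finset V} {x : V} (hx : x ∈ A)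
    (h : ∀ a ∈ A, ∀ b ∈ S, G.Adj a b → b ∈ A) : Reach G S x ⊆ A := by
  have key : ∀ j z, z ∈ ball G S x j → z ∈ A := by
    intro j
    induction j with
    | zero => intro z hj; rw [mem_ball_zero] at hj; rwa [hj]
    | succ j ih =>
      intro z hj
      rcases mem_ball_succ.1 hj with ⟨h1, h2 | ⟨u, h2, h3⟩⟩
      · exact ih z h2
      · exact h u (ih u h2) z h1 h3
  intro z hz
  obtain ⟨_, j, hj⟩ := mem_reach.1 hz
  exact key j z hj

theorem list_reach {V : Type} {G : SimpleGraph V} {S : Finset V} :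
    ∀ {l : List V} {a : V}, (a :: l).IsChain G.Adj → (∀ x ∈ a :: l, x ∈ S) →
      ∀ z ∈ a :: l, z ∈ Reach G S a := by
  intro l
  induction l with
  | nil =>
    intro a _ h z hz
    simp at hz
    rw [hz]; exact self_mem_reach (h a (by simp))
  | cons b l ih =>
    intro a hch h z hz
    rw [List.isChain_cons] at hch
    have haS := h a (by simp)
    rcases List.mem_cons.1 hz with rfl | hz
    · exact self_mem_reach haS
    · have h1 := ih hch.2 (fun x hx => h x (List.mem_cons_of_mem _ hx)) z hz
      exact reach_trans haS (reach_adj (self_mem_reach haS) (h b (by simp)) (hch.1 b (by simp))) h1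

end CycP

open SimpleGraph Finset
namespace CycP
open scoped Classical

def Good {V : Type} (G : SimpleGraph V) (H F : Finset V) (C : ℕ) (x : V) : Prop :=
  x ∈ H \ F ∧ C ≤ al G (Reach G (H \ F) x)

theorem ball_grow {V : Type} {G : SimpleGraph V} {S : Finset V} {C : ℕ} {x : V} (hx : x ∈ S) (h : C ≤ al G (Reach G S x)) (j : ℕ) :
    min (j + 1) C ≤ al G (ball G S x (2 * j)) := by
  induction j with
  | zero =>
    have := one_le_al (G := G) ⟨x, self_mem_ball (G := G) hx (2 * 0)⟩
    omega
  | succ j ih =>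
    by_cases hex : ∃ v ∈ ball G S x (2 * j + 2), v ∉ ball G S x (2 * j + 1)
    · obtain ⟨v, h1, h2⟩ := hex
      have hs : Sep G (ball G S x (2 * j)) {v} := by
        constructor
        · simp only [disjoint_singleton_right]
          exact fun h => h2 (ball_succ hx _ h)
        · intro a ha b hb hab
          rw [mem_singleton] at hb; subst hb
          exact h2 (ball_adj ha (ball_subset hx _ h1) hab)
      have h3 := al_union_ge hs
      have h4 := one_le_al (G := G) (singleton_nonempty v)
      have h5 : al G (ball G S x (2 * j) ∪ {v}) ≤ al G (ball G S x (2 * (j + 1))) :=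
        al_mono (union_subset (ball_mono hx (by omega)) (by rw [singleton_subset_iff]; exact h1))
      omega
    · push Not at hex
      have h1 : Reach G S x ⊆ ball G S x (2 * j + 1) := reach_closed (self_mem_ball hx _)
        (fun a ha b hb hab => hex b (ball_adj ha hb hab))
      have h2 := al_mono (G := G) (h1.trans (ball_mono hx (show 2 * j + 1 ≤ 2 * (j + 1) by omega)))
      omega

namespace Cor
variable {V : Type} {G : SimpleGraph V} {H : Finset V} {lam K : ℝ}

theorem sepC (hc : Cor G H lam K) {C B : ℕ} (hC : 1 ≤ C) (hS : (2 + B) * lam ≤ K / 2 * √(C:ℝ))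
    {A A' F : Finset V} (hA : A ⊆ H) (hA' : A' ⊆ H) (h1 : C ≤ al G A) (h2 : C ≤ al G A')
    (hs : Sep G A A') (hF : H ⊆ A ∪ A' ∪ F) : (2 + B) * lam < F.card :=
  hS.trans_lt (hc.sep hA hA' hC h1 h2 hs hF)

theorem sepC' (hc : Cor G H lam K) {C B : ℕ} (hC : 1 ≤ C) (hS : (2 + B) * lam ≤ K / 2 * √(C:ℝ))
    {A F : Finset V} (hFc : (F.card : ℝ) ≤ 2 * lam) (hA : A ⊆ H \ F) (h1 : C ≤ al G A)
    (hs : Sep G A ((H \ F) \ A)) : al G ((H \ F) \ A) < C := by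
  by_contra h2
  have := hc.sepC hC hS (F := F) (hA.trans sdiff_subset) (sdiff_subset.trans sdiff_subset) h1
    (not_lt.1 h2) hs (by intro z hz; simp only [mem_union, mem_sdiff]; tauto)
  have := mul_nonneg (Nat.cast_nonneg (α := ℝ) B) hc.lam_pos.le
  nlinarith

theorem good_conn (hc : Cor G H lam K) {C B : ℕ} (hC : 1 ≤ C)
    (hS : (2 + B) * lam ≤ K / 2 * √(C:ℝ)) {F : Finset V} (hFc : (F.card : ℝ) ≤ 2 * lam) {x y : V}
    (hx : Good G H F C x) (hy : Good G H F C y) : y ∈ Reach G (H \ F) x := by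
  by_contra hn
  have h1 := hc.sepC' hC hS hFc reach_subset hx.2 reach_sep
  have h2 : Reach G (H \ F) y ⊆ (H \ F) \ Reach G (H \ F) x := by
    intro z hz
    refine mem_sdiff.2 ⟨reach_subset hz, fun hz' => hn ?_⟩
    exact reach_trans hx.1 hz' (reach_symm hy.1 hz)
  have := al_mono (G := G) h2
  have := hy.2
  omega

theorem al_rest (hc : Cor G H lam K) {C : ℕ} (hh : 6 * C + 10 ≤ al G H)
    {F : Finset V} (hFc : (F.card : ℝ) ≤ 2 * lam) : 3 * C ≤ al G (H \ F) := by
  by_cases hd : Disjoint H F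
  · rw [sdiff_eq_self_of_disjoint hd]; omega
  · have hss : H \ F ⊂ H := by
      refine ⟨sdiff_subset, fun h => hd ?_⟩
      rw [Finset.disjoint_left]
      intro a ha
      exact (mem_sdiff.1 (h ha)).2
    have h1 := hc.size hss
    have h2 := hc.card_ge
    have h3 : (H.card : ℝ) ≤ (H \ F).card + F.card := by
      have := le_card_sdiff F H
      exact_mod_cast (show H.card ≤ (H \ F).card + F.card by omega)
    have hl := hc.lam_pos
    have h4 : lam * (3 / 4 * al G H - 2) ≤ lam * al G (H \ F) := by
      have : (3 / 4 * lam) * al G H ≤ (lam - K) * al G H :=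
        mul_le_mul_of_nonneg_right (by have := hc.hKl; linarith) (Nat.cast_nonneg _)
      linarith
    have h5 := le_of_mul_le_mul_left h4 hl
    have h6 : (6 * C + 10 : ℝ) ≤ al G H := by exact_mod_cast hh
    have : (3 * C : ℝ) ≤ al G (H \ F) := by
      have : (0:ℝ) ≤ C := Nat.cast_nonneg _
      linarith
    exact_mod_cast this

theorem good_exists (hc : Cor G H lam K) {C B : ℕ} (hC : 1 ≤ C)
    (hS : (2 + B) * lam ≤ K / 2 * √(C:ℝ)) (hh : 6 * C + 10 ≤ al G H)
    {F : Finset V} (hFc : (F.card : ℝ) ≤ 2 * lam) : ∃ x, Good G H F C x := by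
  have h3 := hc.al_rest hh hFc
  obtain ⟨A, -, ⟨hA1, hA2, hA3⟩, hmin⟩ := exists_min
    (fun A => A ⊆ H \ F ∧ Sep G A ((H \ F) \ A) ∧ C ≤ al G A) (U := H \ F)
    ⟨subset_refl _, ⟨disjoint_sdiff, by simp⟩, by omega⟩
  have hAn : A.Nonempty := by
    by_contra h
    rw [not_nonempty_iff_eq_empty] at h
    rw [h, al_empty] at hA3
    omega
  obtain ⟨x, hx⟩ := hAn
  refine ⟨x, hA1 hx, ?_⟩
  by_contra hlt
  push Not at hlt
  set R := Reach G (H \ F) x with hR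
  have hRA : R ⊆ A := reach_closed hx (fun a ha b hb hab => by
    by_contra hn
    exact hA2.2 a ha b (mem_sdiff.2 ⟨hb, hn⟩) hab)
  have hlt2 : al G (A \ R) < C := by
    by_contra hge
    refine hmin (A \ R) ⟨sdiff_subset, fun h => ?_⟩ ⟨sdiff_subset.trans hA1, ⟨disjoint_sdiff, ?_⟩,
      not_lt.1 hge⟩
    · exact (mem_sdiff.1 (h hx)).2 (self_mem_reach (hA1 hx))
    · intro a ha b hb hab
      rw [mem_sdiff] at ha hb
      by_cases hbR : b ∈ R
      · exact ha.2 (reach_adj hbR (hA1 ha.1) hab.symm)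
      · have : b ∉ A := fun h => hb.2 (mem_sdiff.2 ⟨h, hbR⟩)
        exact hA2.2 a ha.1 b (mem_sdiff.2 ⟨hb.1, this⟩) hab
  have h4 := hc.sepC' hC hS hFc hA1 hA3 hA2
  have h5 := al_union_le (G := G) R (A \ R)
  rw [union_sdiff_of_subset hRA] at h5
  have h6 := al_union_le (G := G) A ((H \ F) \ A)
  rw [union_sdiff_of_subset hA1] at h6
  omega

theorem good_mono {F F' : Finset V} {C : ℕ} {x : V} (h : F ⊆ F') (hx : Good G H F' C x) :
    Good G H F C x :=
  have hs : H \ F' ⊆ H \ F := sdiff_subset_sdiff (subset_refl _) h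
  ⟨hs hx.1, hx.2.trans (al_mono (reach_mono hs))⟩

theorem good_adj {F : Finset V} {C : ℕ} {x y : V} (hx : Good G H F C x) (hy : y ∈ H \ F)
    (h : x ∈ Reach G (H \ F) y) : Good G H F C y :=
  ⟨hy, hx.2.trans (al_mono (fun _ hz => reach_trans hy h hz))⟩

theorem good_step (hc : Cor G H lam K) {C B : ℕ} (hC : 1 ≤ C)
    (hS : (2 + B) * lam ≤ K / 2 * √(C:ℝ)) (hh : 6 * C + 10 ≤ al G H)
    {F : Finset V} {z : V} (hz : Good G H F C z) (hFc : ((insert z F).card : ℝ) ≤ 2 * lam) :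
    ∃ w, G.Adj z w ∧ Good G H (insert z F) C w := by
  obtain ⟨w, hw⟩ := hc.good_exists hC hS hh hFc
  have hFc' : (F.card : ℝ) ≤ 2 * lam := by
    have := card_le_card (subset_insert z F)
    have : (F.card : ℝ) ≤ (insert z F).card := by exact_mod_cast this
    linarith
  have hwF : Good G H F C w := good_mono (subset_insert _ _) hw
  have h1 := hc.good_conn hC hS hFc' hwF hz
  by_contra hn
  push Not at hn
  set R := Reach G (H \ insert z F) w with hR
  have h2 : Reach G (H \ F) w ⊆ R := reach_closed (self_mem_reach hw.1) (by
    intro a ha b hb hab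
    by_cases hbz : b = z
    · subst hbz
      exact absurd (good_adj hw (reach_subset ha) (reach_symm hw.1 ha)) (hn a hab.symm)
    · refine reach_adj ha ?_ hab
      simp only [mem_sdiff, mem_insert] at hb ⊢
      tauto)
  have := reach_subset (h2 h1)
  simp at this

theorem good_ball (hc : Cor G H lam K) {C B J : ℕ} (hC : 1 ≤ C)
    (hS : (2 + B) * lam ≤ K / 2 * √(C:ℝ)) (hJ : al G H < J * B)
    {F : Finset V} (hFc : (F.card : ℝ) ≤ 2 * lam) {x y : V}
    (hx : Good G H F C x) (hy : Good G H F C y) : y ∈ ball G (H \ F) x (4 * C + 2 * J) := by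
  have hbs : ∀ i, ball G (H \ F) x i ⊆ H := fun i => (ball_subset hx.1 i).trans sdiff_subset
  have key : ∀ r, al G ((H \ F) \ ball G (H \ F) x (2 * C + 2 * r)) < C ∨
      C + r * B ≤ al G (ball G (H \ F) x (2 * C + 2 * r)) := by
    intro r
    induction r with
    | zero =>
      right
      have := ball_grow hx.1 hx.2 C
      rw [Nat.min_eq_right (by omega)] at this
      simpa using this
    | succ r ih =>
      set i := 2 * C + 2 * r with hi
      have e : 2 * C + 2 * (r + 1) = i + 2 := by omega
      rw [e]
      by_cases hlt : al G ((H \ F) \ ball G (H \ F) x (i + 2)) < C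
      · exact Or.inl hlt
      right
      push Not at hlt
      rcases ih with ih | ih
      · have : al G ((H \ F) \ ball G (H \ F) x (i + 2)) ≤ al G ((H \ F) \ ball G (H \ F) x i) :=
          al_mono (sdiff_subset_sdiff (subset_refl _) (ball_mono hx.1 (by omega)))
        omega
      · set ring := ball G (H \ F) x (i + 2) \ ball G (H \ F) x (i + 1) with hring
        have h1 := hc.sepC hC hS (A := ball G (H \ F) x (i + 1))
          (A' := (H \ F) \ ball G (H \ F) x (i + 2)) (F := F ∪ ring) (hbs _)
          (sdiff_subset.trans sdiff_subset)
          (by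
            have := al_mono (G := G) (ball_succ (G := G) hx.1 i)
            have : C ≤ C + r * B := Nat.le_add_right _ _
            omega) hlt
          (by
            constructor
            · rw [Finset.disjoint_left]
              intro a ha ha'
              exact (mem_sdiff.1 ha').2 (ball_succ hx.1 _ ha)
            · intro a ha b hb hab
              rw [mem_sdiff] at hb
              exact hb.2 (ball_adj ha hb.1 hab))
          (by
            intro z hz
            simp only [hring, mem_union, mem_sdiff]
            tauto)
        have h2 : ((F ∪ ring).card : ℝ) ≤ F.card + ring.card := by
          exact_mod_cast card_union_le _ _
        have h3 : (B : ℝ) * lam < ring.card := by linarith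
        have h4 : ring ⊂ H := by
          refine ⟨sdiff_subset.trans (hbs _), fun h => ?_⟩
          exact (mem_sdiff.1 (h (mem_sdiff.1 hx.1).1)).2 (self_mem_ball hx.1 _)
        have h5 := hc.size h4
        have h6 : (B:ℝ) < al G ring := by
          have : lam * (B:ℝ) < lam * al G ring := by linarith
          exact lt_of_mul_lt_mul_left this hc.lam_pos.le
        have h7 : B < al G ring := by exact_mod_cast h6
        have h8 : Sep G (ball G (H \ F) x i) ring := by
          constructor
          · rw [Finset.disjoint_left]
            intro a ha ha'
            exact (mem_sdiff.1 ha').2 (ball_succ hx.1 _ ha)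
          · intro a ha b hb hab
            rw [hring, mem_sdiff] at hb
            exact hb.2 (ball_adj ha (ball_subset hx.1 _ hb.1) hab)
        have h9 := al_union_ge h8
        have h10 : al G (ball G (H \ F) x i ∪ ring) ≤ al G (ball G (H \ F) x (i + 2)) :=
          al_mono (union_subset (ball_mono hx.1 (by omega)) sdiff_subset)
        have : (r + 1) * B = r * B + B := by ring
        omega
  have h1 : al G ((H \ F) \ ball G (H \ F) x (2 * C + 2 * J)) < C := by
    rcases key J with h | h
    · exact h
    · have := al_mono (G := G) (hbs (2 * C + 2 * J))
      omega
  have h2 := ball_grow hy.1 hy.2 C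
  rw [Nat.min_eq_right (by omega)] at h2
  have h3 : ∃ w ∈ ball G (H \ F) y (2 * C), w ∈ ball G (H \ F) x (2 * C + 2 * J) := by
    by_contra hn
    push Not at hn
    have : ball G (H \ F) y (2 * C) ⊆ (H \ F) \ ball G (H \ F) x (2 * C + 2 * J) :=
      fun w hw => mem_sdiff.2 ⟨ball_subset hy.1 _ hw, hn w hw⟩
    have := al_mono (G := G) this
    omega
  obtain ⟨w, hw1, hw2⟩ := h3
  have := ball_trans hx.1 hw2 (ball_symm hy.1 hw1)
  exact ball_mono hx.1 (by omega) this

end Cor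
end CycP

open SimpleGraph Finset
namespace CycP
open scoped Classical

theorem exists_Y {V : Type} {G : SimpleGraph V} {H : Finset V} {C : ℕ} (hC : 1 ≤ C) {v : V}
    (hv : v ∈ H) (h : C ≤ al G (Reach G H v)) : ∃ Y, Y ⊆ H ∧ Y.card ≤ C * (2 * C + 1) ∧
      C ≤ al G Y ∧ v ∈ Y ∧ Y ⊆ Reach G Y v := by
  have h1 := ball_grow hv h C
  rw [Nat.min_eq_right (by omega)] at h1
  obtain ⟨I0, hI0, hI1, hI2⟩ := exists_ind G (ball G H v (2 * C))
  obtain ⟨I, hI, hIc⟩ := exists_subset_card_eq (show C ≤ I0.card by omega)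
  have hp : ∀ u ∈ I, ∃ l : List V, Pth G H (v :: l) ∧ u ∈ v :: l ∧ (v :: l).length ≤ 2 * C + 1 := by
    intro u hu
    obtain ⟨m, hm, l, hl1, hl2, hl3, hl4⟩ := ball_path hv (hI0 (hI hu))
    rcases l with _ | ⟨a, l⟩
    · simp at hl2
    · simp at hl2
      subst hl2
      exact ⟨l, hl1.mono (ball_subset hv _), List.mem_of_getLast? hl3, by omega⟩
  choose! l hl1 hl2 hl3 using hp
  set Y := I.biUnion fun u => (v :: l u).toFinset with hY
  have hsub : ∀ u ∈ I, ∀ x ∈ v :: l u, x ∈ Y := by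
    intro u hu x hx
    rw [hY, mem_biUnion]
    exact ⟨u, hu, List.mem_toFinset.2 hx⟩
  obtain ⟨u0, hu0⟩ := card_pos.1 (show 0 < I.card by omega)
  refine ⟨Y, ?_, ?_, ?_, hsub u0 hu0 v (by simp), ?_⟩
  · intro x hx
    rw [hY, mem_biUnion] at hx
    obtain ⟨u, hu, hx⟩ := hx
    exact (hl1 u hu).sub x (List.mem_toFinset.1 hx)
  · rw [← hIc]
    conv_rhs => rw [hIc]
    rw [hY]
    refine (card_biUnion_le_card_mul I _ (2 * C + 1) ?_).trans (by rw [hIc])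
    intro u hu
    exact (List.toFinset_card_le _).trans (hl3 u hu)
  · rw [← hIc]
    exact card_le_al (fun u hu => hsub u hu u (hl2 u hu)) (hI1.subset hI)
  · intro x hx
    rw [hY, mem_biUnion] at hx
    obtain ⟨u, hu, hx⟩ := hx
    exact list_reach (hl1 u hu).ch (hsub u hu) x (List.mem_toFinset.1 hx)

theorem Cor.core_large {V : Type} {G : SimpleGraph V} {H : Finset V} {lam K : ℝ}
    (hc : Cor G H lam K) {C B J D0 ℓ : ℕ} (hC : 1 ≤ C)
    (hS : (2 + B) * lam ≤ K / 2 * √(C:ℝ)) (hJ : al G H < J * B) (hh : 6 * C + 10 ≤ al G H)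
    (hD0 : D0 = 4 * C + 2 * J)
    (hlam : (al G H : ℝ) + 2 * D0 + C * (2 * C + 1) + K + 2 ≤ lam)
    (hK2 : 2 * (D0:ℝ) + 1 + C * (2 * C + 1) ≤ K / 2) (hℓ1 : 2 * D0 + 2 ≤ ℓ) (hℓ2 : (ℓ:ℝ) ≤ lam)
    (hℓ3 : 3 ≤ ℓ) : HasCycleLength G ℓ := by
  have hKl := hc.hKl
  have hl := hc.lam_pos
  obtain ⟨y0, hy0⟩ := hc.good_exists hC hS hh (F := ∅) (by simp; exact hl.le)
  have hy0' := hy0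
  simp only [Good, sdiff_empty] at hy0'
  obtain ⟨Y, hYH, hYc, hYal, hy0Y, hYr⟩ := exists_Y hC hy0'.1 hy0'.2
  set CC := C * (2 * C + 1) with hCC
  have hCCr : (CC:ℝ) = C * (2 * C + 1) := by rw [hCC]; push_cast; ring
  rw [← hCCr] at hlam hK2
  have hYgood : ∀ F, Disjoint F Y → Good G H F C y0 := by
    intro F hF
    have hs : Y ⊆ H \ F := fun y hy => mem_sdiff.2 ⟨hYH hy, Finset.disjoint_right.1 hF hy⟩
    exact ⟨hs hy0Y, hYal.trans (al_mono (hYr.trans (reach_mono hs)))⟩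
  have hdeg := hc.degN (n := al G H + 2 * D0 + CC + 1) (by push_cast; linarith)
  have nbr : ∀ w ∈ H, ∀ X : Finset V, X.card ≤ al G H + 2 * D0 + CC →
      ∃ z ∈ H, G.Adj w z ∧ z ∉ X := by
    intro w hw X hX
    have h1 := hdeg w hw
    have h3 := le_card_sdiff X (nb G H w)
    obtain ⟨z, hz⟩ := card_pos.1 (show 0 < (nb G H w \ X).card by omega)
    rw [mem_sdiff, mem_nb] at hz
    exact ⟨z, hz.1.1, hz.1.2, hz.2⟩
  obtain ⟨q0, hq0H, hq0adj, hq0Y⟩ := nbr y0 (hYH hy0Y) Y (by omega)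
  have inv : ∀ i, D0 + 1 + i ≤ ℓ - D0 - 1 → ∃ F q, F ⊆ H ∧ q0 ∈ F ∧ Disjoint F Y ∧
      F.card ≤ D0 + 1 + i + D0 ∧ (∀ e, D0 + 1 + i ≤ e → e ≤ D0 + 1 + i + D0 → PV G F q0 q e) ∧
      ∃ z, G.Adj q z ∧ Good G H (F ∪ Y) C z := by
    intro i
    induction i with
    | zero =>
      intro _
      obtain ⟨F, q, h1, h2, h3, h4, h5, h6⟩ := flex hdeg hq0H hq0Y D0 (by omega)
      refine ⟨F, q, h1, h2, h4, by omega, fun e he1 he2 => h6 e (by omega) (by omega), ?_⟩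
      have hFY := card_union_le F Y
      obtain ⟨z, hzH, hz1, hz2⟩ := nbr q (h1 h3) (F ∪ Y) (by omega)
      refine ⟨z, hz1, ?_⟩
      have hFYr : ((F ∪ Y).card : ℝ) ≤ K / 2 := by
        have : ((F ∪ Y).card : ℝ) ≤ 2 * D0 + 1 + CC := by
          exact_mod_cast (show (F ∪ Y).card ≤ 2 * D0 + 1 + CC by omega)
        linarith
      obtain ⟨w, hw⟩ := hc.good_exists hC hS hh (F := F ∪ Y) (by linarith)
      have hzs : z ∈ H \ (F ∪ Y) := mem_sdiff.2 ⟨hzH, hz2⟩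
      exact Cor.good_adj hw hzs (hc.conn hFYr hzs hw.1)
    | succ i ih =>
      intro hi
      obtain ⟨F, q, h1, h2, h4, h5, h6, z, hz1, hz2⟩ := ih (by omega)
      have hzn := (mem_sdiff.1 hz2.1)
      have hzF : z ∉ F := fun h => hzn.2 (mem_union_left _ h)
      have hzY : z ∉ Y := fun h => hzn.2 (mem_union_right _ h)
      refine ⟨F ∪ {z}, z, union_subset h1 (by simpa using hzn.1), mem_union_left _ h2, ?_, ?_, ?_, ?_⟩
      · rw [Finset.disjoint_union_left]
        exact ⟨h4, by simpa using hzY⟩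
      · have := card_union_le F {z}
        rw [card_singleton] at this
        omega
      · intro e he1 he2
        have := (h6 (e - 1) (by omega) (by omega)).append (PV.single (mem_singleton_self z))
          (by simpa using hzF) hz1
        rwa [Nat.sub_add_cancel (by omega)] at this
      · have hcard : ((insert z (F ∪ Y)).card : ℝ) ≤ 2 * lam := by
          have a1 := card_insert_le z (F ∪ Y)
          have a2 := card_union_le F Y
          have a3 : ((insert z (F ∪ Y)).card : ℝ) ≤ ℓ + CC := by
            exact_mod_cast (show (insert z (F ∪ Y)).card ≤ ℓ + CC by omega)
          have : (0:ℝ) ≤ D0 := Nat.cast_nonneg _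
          linarith
        obtain ⟨w, hw1, hw2⟩ := hc.good_step hC hS hh hz2 hcard
        refine ⟨w, hw1, ?_⟩
        have e : F ∪ {z} ∪ Y = insert z (F ∪ Y) := by
          ext a; simp only [mem_union, mem_insert, mem_singleton]; tauto
        rw [e]; exact hw2
  obtain ⟨F, q, h1, h2, h4, h5, h6, z, hz1, hz2⟩ := inv (ℓ - D0 - 1 - (D0 + 1)) (by omega)
  have hFc : (F.card : ℝ) ≤ 2 * lam := by
    have : (F.card : ℝ) ≤ ℓ := by exact_mod_cast (show F.card ≤ ℓ by omega)
    linarith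
  have hzF : Good G H F C z := Cor.good_mono subset_union_left hz2
  have hb := hc.good_ball hC hS hJ hFc hzF (hYgood F h4)
  rw [← hD0] at hb
  obtain ⟨t, ht, hp⟩ := ball_path hzF.1 hb
  have ht1 := hp.one_le
  have hdis : Disjoint F (ball G (H \ F) z D0) :=
    disjoint_of_subset_right (ball_subset hzF.1 _) disjoint_sdiff
  have p := (h6 (ℓ - t) (by omega) (by omega)).append hp hdis hz1
  rw [Nat.sub_add_cancel (by omega)] at p
  exact p.cycle hq0adj hℓ3

end CycP

open SimpleGraph Finset
namespace CycP
open scoped Classical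

theorem core_thm (c δ : ℝ) (hc2 : 2 ≤ c) (hδ : 0 < δ) (hδ2 : δ ≤ 1 / 10) :
    ∃ k0 : ℕ, ∀ k : ℕ, k0 ≤ k → ∀ (V : Type) (G : SimpleGraph V) (V0 : Finset V) (lam : ℝ) (ℓ : ℕ),
      2 * (k:ℝ) ≤ lam → lam ≤ c * k → (k:ℝ) / 2 ≤ ℓ → (ℓ:ℝ) ≤ lam → V0.Nonempty → al G V0 ≤ k →
      lam * al G V0 - δ * k * √(al G V0 : ℝ) ≤ V0.card →
      HasCycleLength G ℓ ∨ ∃ R, R ⊆ V0 ∧ Clq G R ∧ lam - δ * k ≤ R.card := by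
  obtain ⟨B, hB⟩ := exists_nat_ge (16 / δ)
  obtain ⟨C, hC⟩ := exists_nat_ge ((2 * (2 + B) * c / δ) ^ 2)
  set CC := C * (2 * C + 1) with hCC
  obtain ⟨k0, hk0⟩ := exists_nat_ge ((60 * C + 104 + 4 * (8 * C + 6 + CC) + 10 : ℝ) / δ)
  have hBpos : (0:ℝ) < B := lt_of_lt_of_le (by positivity) hB
  have hBn : 0 < B := by exact_mod_cast hBpos
  have hCpos : (0:ℝ) < C := lt_of_lt_of_le (by positivity) hC
  have hCn : 1 ≤ C := by exact_mod_cast hCpos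
  have hBδ : 16 ≤ B * δ := by rwa [div_le_iff₀ hδ] at hB
  refine ⟨k0, ?_⟩
  intro k hk V G V0 lam ℓ hl1 hl2 hℓ1 hℓ2 hne hal hbig
  have hkr : (60 * C + 104 + 4 * (8 * C + 6 + CC) + 10 : ℝ) ≤ δ * k := by
    have h1 : (k0:ℝ) ≤ k := by exact_mod_cast hk
    have h2 := hk0.trans h1
    rw [div_le_iff₀ hδ] at h2
    linarith
  have hCCnn : (0:ℝ) ≤ CC := Nat.cast_nonneg _
  have hδk : 0 < δ * k := by linarith
  have hkpos : (0:ℝ) < k := by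
    by_contra h
    push Not at h
    have := mul_nonneg hδ.le (neg_nonneg.2 h)
    linarith
  have hδk2 : δ * k ≤ k / 10 := by
    have := mul_le_mul_of_nonneg_right hδ2 hkpos.le
    linarith
  obtain ⟨H, hHV, hcor⟩ := exists_cor (K := δ * k) hne hbig hδk (by linarith)
  have hhk : al G H ≤ k := (al_mono hHV).trans hal
  have hhk' : (al G H : ℝ) ≤ k := by exact_mod_cast hhk
  by_cases h1 : al G H ≤ 1
  · right
    refine ⟨H, hHV, clq_of_al h1, ?_⟩
    have h2 := hcor.card_ge
    have h3 : al G H = 1 := le_antisymm h1 (one_le_al hcor.ne)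
    rw [h3] at h2
    simpa using h2
  · left
    by_cases h5 : 5 * (al G H : ℝ) + 2 ≤ δ * k / 2
    · exact hcor.core_small (by omega) h5 (by linarith) hℓ2
    · push Not at h5
      have hJ : al G H < (al G H / B + 1) * B := by
        have := Nat.lt_div_mul_add (a := al G H) hBn
        linarith [Nat.add_mul (al G H / B) 1 B]
      set J := al G H / B + 1 with hJd
      have hJr : 4 * (J:ℝ) ≤ δ * k / 4 + 4 := by
        have a1 : ((al G H / B : ℕ) : ℝ) ≤ (al G H : ℝ) / B := Nat.cast_div_le
        have a2 : (al G H : ℝ) / B ≤ k * δ / 16 := by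
          rw [div_le_div_iff₀ hBpos (by norm_num)]
          have := mul_le_mul_of_nonneg_left hBδ hkpos.le
          linarith
        rw [hJd]
        push_cast
        linarith
      have hD : 2 * ((4 * C + 2 * J : ℕ):ℝ) + 1 + C * (2 * C + 1) ≤ δ * k / 2 := by
        have : (CC:ℝ) = C * (2 * C + 1) := by rw [hCC]; push_cast; ring
        rw [← this]
        push_cast
        linarith
      refine hcor.core_large (C := C) (B := B) (J := J) hCn ?_ hJ ?_ rfl ?_ hD ?_ hℓ2 ?_
      · have h6 : 2 * (2 + B) * c / δ ≤ √(C:ℝ) := Real.le_sqrt_of_sq_le hC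
        rw [div_le_iff₀ hδ] at h6
        have h7 := mul_le_mul_of_nonneg_left hl2 (show (0:ℝ) ≤ 2 + B by positivity)
        have h8 := mul_le_mul_of_nonneg_right h6 hkpos.le
        nlinarith
      · have : (6 * C + 10 : ℝ) ≤ al G H := by linarith
        exact_mod_cast this
      · linarith
      · have : 2 * ((4 * C + 2 * J : ℕ):ℝ) + 2 ≤ ℓ := by
          have : (0:ℝ) ≤ C * (2 * C + 1) := by positivity
          linarith
        exact_mod_cast this
      · have : (3:ℝ) ≤ ℓ := by linarith
        exact_mod_cast this

end CycP

open SimpleGraph Finset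
namespace CycP
open scoped Classical
variable {V : Type} {G : SimpleGraph V}

theorem PV.glue {S T : Finset V} {u d v : V} {m m' : ℕ} (h : PV G S u d m) (h' : PV G T d v m')
    (hST : ∀ x ∈ S, x ∈ T → x = d) : PV G (S ∪ T) u v (m + m' - 1) := by
  obtain ⟨l, h1, h2, h3, h4⟩ := h
  obtain ⟨l', h1', h2', h3', h4'⟩ := h'
  rcases l' with _ | ⟨a, t⟩
  · simp at h2'
  · simp only [List.head?_cons, Option.some.injEq] at h2'
    subst h2'
    have hnd := List.nodup_cons.1 h1'.nd
    have hch := List.isChain_cons.1 h1'.ch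
    refine ⟨l ++ t, h1.append ⟨hch.2, hnd.2, fun x hx => h1'.sub x (List.mem_cons_of_mem _ hx)⟩
      ?_ ?_, ?_, ?_, ?_⟩
    · intro x hx hx'
      have := hST x (h1.sub x hx) (h1'.sub x (List.mem_cons_of_mem _ hx'))
      subst this
      exact hnd.1 hx'
    · rw [h3]
      intro x hx y hy
      simp only [Option.mem_def, Option.some.injEq] at hx
      subst hx
      exact hch.1 y hy
    · rw [List.head?_append, h2]; rfl
    · rw [List.getLast?_append]
      rcases t with _ | ⟨b, t⟩
      · simp at h3' ⊢
        rw [h3, h3']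
      · rw [List.getLast?_cons_cons] at h3'
        rw [h3']; rfl
    · simp at h4' ⊢
      omega

theorem list_trunc (R : Finset V) : ∀ l : List V, (∃ x ∈ l, x ∈ R) →
    ∃ s u t, l = s ++ u :: t ∧ u ∈ R ∧ ∀ x ∈ t, x ∉ R := by
  intro l
  induction l with
  | nil => intro h; simp at h
  | cons a l ih =>
    intro h
    by_cases hl : ∃ x ∈ l, x ∈ R
    · obtain ⟨s, u, t, h1, h2, h3⟩ := ih hl
      exact ⟨a :: s, u, t, by simp [h1], h2, h3⟩
    · obtain ⟨x, hx, hxR⟩ := h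
      rcases List.mem_cons.1 hx with rfl | hx
      · exact ⟨[], x, l, rfl, hxR, fun y hy hyR => hl ⟨y, hy, hyR⟩⟩
      · exact absurd ⟨x, hx, hxR⟩ hl

theorem Pth.right {S : Finset V} {l1 l2 : List V} (h : Pth G S (l1 ++ l2)) :
    Pth G l2.toFinset l2 :=
  ⟨(List.isChain_append.1 h.ch).2.1, (List.nodup_append.1 h.nd).2.1, fun x hx => by simpa using hx⟩

theorem Pth.left {S : Finset V} {l1 l2 : List V} (h : Pth G S (l1 ++ l2)) :
    Pth G l1.toFinset l1 :=
  ⟨(List.isChain_append.1 h.ch).1, (List.nodup_append.1 h.nd).1, fun x hx => by simpa using hx⟩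

theorem PV.trunc {S R : Finset V} {u v : V} {m : ℕ} (h : PV G S u v m) (hu : u ∈ R) :
    ∃ S' u' m', S' ⊆ S ∧ u' ∈ R ∧ PV G S' u' v m' ∧ ∀ x ∈ S', x ∈ R → x = u' := by
  obtain ⟨l, h1, h2, h3, h4⟩ := h
  obtain ⟨s, u', t, rfl, h6, h7⟩ := list_trunc R l ⟨u, List.mem_of_mem_head? h2, hu⟩
  refine ⟨(u' :: t).toFinset, u', _, ?_, h6, ⟨u' :: t, h1.right, rfl, ?_, rfl⟩, ?_⟩
  · intro x hx
    exact h1.sub x (List.mem_append_right _ (List.mem_toFinset.1 hx))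
  · rw [List.getLast?_append] at h3
    rw [List.getLast?_cons] at h3 ⊢
    simpa using h3
  · intro x hx hxR
    rcases List.mem_cons.1 (List.mem_toFinset.1 hx) with rfl | hx
    · rfl
    · exact absurd hxR (h7 x hx)

theorem split_mem {S : Finset V} {p : List V} (h : Pth G S p) {w : V} (hw : w ∈ p) :
    (∀ z, p.head? = some z → ∃ m, PV G p.toFinset w z m) ∧
    (∀ z, p.getLast? = some z → ∃ m, PV G p.toFinset w z m) := by
  obtain ⟨l1, l2, rfl⟩ := List.append_of_mem hw
  constructor
  · intro z hz
    have e : l1 ++ w :: l2 = (l1 ++ [w]) ++ l2 := by simp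
    refine ⟨_, PV.symm ⟨l1 ++ [w], ?_, ?_, ?_, rfl⟩⟩
    · rw [e] at h
      exact h.left.mono (by intro x; simp; tauto)
    · rw [e] at hz
      rw [List.head?_append] at hz
      cases l1 <;> simpa using hz
    · simp
  · intro z hz
    refine ⟨_, w :: l2, ?_, rfl, ?_, rfl⟩
    · exact h.right.mono (by intro x; simp; tauto)
    · rw [List.getLast?_append] at hz
      rw [List.getLast?_cons] at hz ⊢
      simpa using hz

theorem split_two {S : Finset V} {p : List V} (h : Pth G S p) {w w' za zb : V} (hw : w ∈ p)
    (hw' : w' ∈ p) (hne : w ≠ w') (ha : p.head? = some za) (hb : p.getLast? = some zb) :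
    ∃ S1 S2 m1 m2, S1 ⊆ p.toFinset ∧ S2 ⊆ p.toFinset ∧ Disjoint S1 S2 ∧
      ((PV G S1 w za m1 ∧ PV G S2 w' zb m2) ∨ (PV G S1 w zb m1 ∧ PV G S2 w' za m2)) := by
  obtain ⟨l1, l2, rfl⟩ := List.append_of_mem hw
  have e : l1 ++ w :: l2 = (l1 ++ [w]) ++ l2 := by simp
  have h' := h
  rw [e] at h'
  have hnd := List.nodup_append.1 h.nd
  have hnd' := List.nodup_append.1 h'.nd
  rcases List.mem_append.1 hw' with hw1 | hw1
  · obtain ⟨m2, hm2⟩ := (split_mem h.left hw1).1 za (by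
      cases l1 with
      | nil => simp at hw1
      | cons c l => simpa using ha)
    obtain ⟨m1, hm1⟩ := (split_mem h.right (List.mem_cons_self)).2 zb (by
      rw [List.getLast?_append] at hb
      rw [List.getLast?_cons] at hb ⊢
      simpa using hb)
    refine ⟨_, _, m1, m2, ?_, ?_, ?_, Or.inr ⟨hm1, hm2⟩⟩
    · intro x; simp; tauto
    · intro x; simp; tauto
    · rw [Finset.disjoint_left]
      intro x hx hx'
      exact hnd.2.2 x (List.mem_toFinset.1 hx') x (List.mem_toFinset.1 hx) rfl
  · have hw2 : w' ∈ l2 := by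
      rcases List.mem_cons.1 hw1 with rfl | h2
      · exact absurd rfl hne
      · exact h2
    obtain ⟨m2, hm2⟩ := (split_mem h'.right hw2).2 zb (by
      cases l2 with
      | nil => simp at hw2
      | cons c l =>
        rw [List.getLast?_append] at hb
        rw [List.getLast?_cons_cons, List.getLast?_cons] at hb
        rw [List.getLast?_cons]
        simpa using hb)
    obtain ⟨m1, hm1⟩ := (split_mem h'.left (w := w) (by simp)).1 za (by
      cases l1 <;> simpa using ha)
    refine ⟨_, _, m1, m2, ?_, ?_, ?_, Or.inl ⟨hm1, hm2⟩⟩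
    · intro x; simp; tauto
    · intro x; simp; tauto
    · rw [Finset.disjoint_left]
      intro x hx hx'
      exact hnd'.2.2 x (List.mem_toFinset.1 hx) x (List.mem_toFinset.1 hx') rfl

def Lk {V : Type} (G : SimpleGraph V) (W D : Finset V) (w w' : V) : Prop :=
  ∃ S T d d' m m', S ⊆ W ∧ T ⊆ W ∧ Disjoint S T ∧ d ∈ D ∧ d' ∈ D ∧ PV G S w d m ∧ PV G T w' d' m'

theorem Lk.symm {W D : Finset V} {w w' : V} (h : Lk G W D w w') : Lk G W D w' w := by
  obtain ⟨S, T, d, d', m, m', h1, h2, h3, h4, h5, h6, h7⟩ := h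
  exact ⟨T, S, d', d, m', m, h2, h1, h3.symm, h5, h4, h7, h6⟩

theorem Lk.mono {W W' D : Finset V} {w w' : V} (h : Lk G W D w w') (hW : W ⊆ W') :
    Lk G W' D w w' := by
  obtain ⟨S, T, d, d', m, m', h1, h2, h3⟩ := h
  exact ⟨S, T, d, d', m, m', h1.trans hW, h2.trans hW, h3⟩

theorem Lk.ext {W D S1 : Finset V} {a w' w z : V} {n : ℕ} (h : Lk G W D a w')
    (hp : PV G S1 w z n) (hd : Disjoint S1 W) (hadj : G.Adj z a) : Lk G (W ∪ S1) D w w' := by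
  obtain ⟨S, T, d, d', m, m', h1, h2, h3, h4, h5, h6, h7⟩ := h
  refine ⟨S1 ∪ S, T, d, d', n + m, m', ?_, ?_, ?_, h4, h5, ?_, h7⟩
  · exact union_subset subset_union_right (h1.trans subset_union_left)
  · exact h2.trans subset_union_left
  · rw [Finset.disjoint_union_left]
    exact ⟨disjoint_of_subset_right h2 hd, h3⟩
  · exact hp.append h6 (disjoint_of_subset_right h1 hd) hadj

theorem linked {U D : Finset V} (hDU : D ⊆ U) (hD2 : 2 ≤ D.card)
    (hcut : ∀ v, ∀ x ∈ U \ {v}, ∀ y ∈ U \ {v}, y ∈ Reach G (U \ {v}) x) :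
    ∀ w ∈ U, ∀ w' ∈ U, w ≠ w' → Lk G U D w w' := by
  set P : Finset V → Prop := fun W => D ⊆ W ∧ ∀ w ∈ W, ∀ w' ∈ W, w ≠ w' → Lk G W D w w' with hP
  have hPD : P D := by
    refine ⟨subset_refl _, fun w hw w' hw' hne => ?_⟩
    refine ⟨{w}, {w'}, w, w', 1, 1, by simpa using hw, by simpa using hw', by simpa using hne, hw,
      hw', PV.single (by simp), PV.single (by simp)⟩
  obtain ⟨W, hW, hmax⟩ := exists_max_image (U.powerset.filter P) card
    ⟨D, by rw [mem_filter, mem_powerset]; exact ⟨hDU, hPD⟩⟩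
  rw [mem_filter, mem_powerset] at hW
  obtain ⟨hWU, hDW, hWL⟩ := hW
  by_cases hUW : U ⊆ W
  · have : U = W := subset_antisymm hUW hWU
    rw [this]; exact hWL
  exfalso
  obtain ⟨x, hxU, hxW⟩ := not_subset.1 hUW
  have hxS : x ∈ U \ W := mem_sdiff.2 ⟨hxU, hxW⟩
  have hW2 : 1 < W.card := lt_of_lt_of_le (by omega) (card_le_card hDW)
  have att : ∀ v ∈ W, ∃ a ∈ W, a ≠ v ∧ ∃ z ∈ Reach G (U \ W) x, G.Adj z a := by
    intro v hv
    by_contra hn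
    push Not at hn
    obtain ⟨w, hw, hwv⟩ := exists_mem_ne hW2 v
    have h1 := hcut v x (by
      simp only [mem_sdiff, mem_singleton]
      exact ⟨hxU, fun h => hxW (h ▸ hv)⟩) w (by
      simp only [mem_sdiff, mem_singleton]
      exact ⟨hWU hw, hwv⟩)
    have h2 : Reach G (U \ {v}) x ⊆ Reach G (U \ W) x := reach_closed (self_mem_reach hxS) (by
      intro a ha b hb hab
      simp only [mem_sdiff, mem_singleton] at hb
      by_cases hbW : b ∈ W
      · exact absurd hab (hn b hbW hb.2 a ha)
      · exact reach_adj ha (mem_sdiff.2 ⟨hb.1, hbW⟩) hab)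
    exact (mem_sdiff.1 (reach_subset (h2 h1))).2 hw
  obtain ⟨v0, hv0⟩ := card_pos.1 (show 0 < W.card by omega)
  obtain ⟨a, haW, -, za, hza, hzaa⟩ := att v0 hv0
  obtain ⟨b, hbW, hba, zb, hzb, hzbb⟩ := att a haW
  have hzaS := reach_subset hza
  obtain ⟨m, p, hp1, hp2, hp3, hp4⟩ := reach_path hzaS (reach_trans hzaS (reach_symm hxS hza) hzb)
  have hp := hp1.mono reach_subset
  have hpd : Disjoint p.toFinset W := by
    rw [Finset.disjoint_left]
    intro y hy
    exact (mem_sdiff.1 (hp.sub y (List.mem_toFinset.1 hy))).2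
  have hzap : za ∈ p := List.mem_of_mem_head? hp2
  have mixed : ∀ w ∈ p, ∀ w' ∈ W, Lk G (W ∪ p.toFinset) D w w' := by
    intro w hw w' hw'
    by_cases hh : a = w'
    · obtain ⟨n, hn⟩ := (split_mem hp hw).2 zb hp3
      exact (hWL b hbW w' hw' (by rw [← hh]; exact hba)).ext hn hpd hzbb
    · obtain ⟨n, hn⟩ := (split_mem hp hw).1 za hp2
      exact (hWL a haW w' hw' hh).ext hn hpd hzaa
  have hPW : P (W ∪ p.toFinset) := by
    refine ⟨hDW.trans subset_union_left, ?_⟩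
    intro w hw w' hw' hne
    rw [mem_union, List.mem_toFinset] at hw hw'
    rcases hw with hw | hw <;> rcases hw' with hw' | hw'
    · exact (hWL w hw w' hw' hne).mono subset_union_left
    · exact (mixed w' hw' w hw).symm
    · exact mixed w hw w' hw'
    · obtain ⟨S1, S2, m1, m2, hs1, hs2, hs3, hs4⟩ := split_two hp hw hw' hne hp2 hp3
      have d1 : Disjoint S1 W := disjoint_of_subset_left hs1 hpd
      have d2 : Disjoint S2 (W ∪ S1) := by
        rw [Finset.disjoint_union_right]
        exact ⟨disjoint_of_subset_left hs2 hpd, hs3.symm⟩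
      have hsub : W ∪ S1 ∪ S2 ⊆ W ∪ p.toFinset :=
        union_subset (union_subset_union (subset_refl _) hs1) (hs2.trans subset_union_right)
      rcases hs4 with ⟨g1, g2⟩ | ⟨g1, g2⟩
      · exact (((hWL a haW b hbW hba.symm).ext g1 d1 hzaa).symm.ext g2 d2 hzbb).symm.mono hsub
      · exact (((hWL b hbW a haW hba).ext g1 d1 hzbb).symm.ext g2 d2 hzaa).symm.mono hsub
  have hle := hmax (W ∪ p.toFinset) (by
    rw [mem_filter, mem_powerset]
    refine ⟨union_subset hWU ?_, hPW⟩
    intro y hy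
    exact (mem_sdiff.1 (hp.sub y (List.mem_toFinset.1 hy))).1)
  rw [card_union_of_disjoint hpd.symm] at hle
  have : 0 < p.toFinset.card := card_pos.2 ⟨za, List.mem_toFinset.2 hzap⟩
  omega

end CycP

open SimpleGraph Finset
namespace CycP
open scoped Classical

theorem long_link {V : Type} {G : SimpleGraph V} {U D R : Finset V} {N : ℕ} (hDU : D ⊆ U)
    (hRU : R ⊆ U) (hDR : Disjoint D R) (hD2 : 2 ≤ D.card) (hR2 : 2 ≤ R.card)
    (hcut : ∀ v, ∀ x ∈ U \ {v}, ∀ y ∈ U \ {v}, y ∈ Reach G (U \ {v}) x)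
    (hlong : ∀ d1 ∈ D, ∀ d2 ∈ D, d1 ≠ d2 → ∃ m, N ≤ m ∧ PV G D d1 d2 m) :
    ∃ Q r1 r2 m, Q ⊆ U ∧ r1 ∈ R ∧ r2 ∈ R ∧ r1 ≠ r2 ∧ N ≤ m ∧ PV G Q r1 r2 m ∧
      ∀ x ∈ Q, x ∈ R → x = r1 ∨ x = r2 := by
  obtain ⟨r, hr, r', hr', hrr⟩ := one_lt_card.1 (show 1 < R.card by omega)
  obtain ⟨S, T, d, d', m, m', h1, h2, h3, h4, h5, h6, h7⟩ :=
    linked hDU hD2 hcut r (hRU hr) r' (hRU hr') hrr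
  have clean : ∀ S r d m, r ∈ R → d ∈ D → PV G S r d m → ∃ S2 r1 d1 m2, S2 ⊆ S ∧ r1 ∈ R ∧
      d1 ∈ D ∧ PV G S2 r1 d1 m2 ∧ (∀ x ∈ S2, x ∈ D → x = d1) ∧ ∀ x ∈ S2, x ∈ R → x = r1 := by
    intro S r d m hr hd hp
    obtain ⟨S1, d1, m1, a1, a2, a3, a4⟩ := hp.symm.trunc hd
    obtain ⟨S2, r1, m2, b1, b2, b3, b4⟩ := a3.symm.trunc hr
    exact ⟨S2, r1, d1, m2, b1.trans a1, b2, a2, b3, fun x hx => a4 x (b1 hx), b4⟩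
  obtain ⟨S2, r1, d1, m1, a1, a2, a3, a4, a5, a6⟩ := clean S r d m hr h4 h6
  obtain ⟨T2, r2, d2, m2, b1, b2, b3, b4, b5, b6⟩ := clean T r' d' m' hr' h5 h7
  have hdis : Disjoint S2 T2 := disjoint_of_subset_left a1 (disjoint_of_subset_right b1 h3)
  obtain ⟨M, hM, hp⟩ := hlong d1 a3 d2 b3 (fun e =>
    Finset.disjoint_left.1 hdis a4.right_mem (e ▸ b4.right_mem))
  have g1 := a4.glue hp a5
  have g2 := g1.glue b4.symm (by
    intro x hx hx'
    rcases mem_union.1 hx with hx | hx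
    · exact absurd hx' (Finset.disjoint_left.1 hdis hx)
    · exact b5 x hx' hx)
  refine ⟨_, r1, r2, _, ?_, a2, b2, ?_, ?_, g2, ?_⟩
  · exact union_subset (union_subset (a1.trans h1) hDU) (b1.trans h2)
  · exact fun e => Finset.disjoint_left.1 hdis a4.left_mem (e ▸ b4.left_mem)
  · have := a4.one_le
    have := b4.one_le
    omega
  · intro x hx hxR
    simp only [mem_union] at hx
    rcases hx with (hx | hx) | hx
    · exact Or.inl (a6 x hx hxR)
    · exact absurd hxR (Finset.disjoint_left.1 hDR hx)
    · exact Or.inr (b6 x hx hxR)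

theorem finish {V : Type} {G : SimpleGraph V} {Q R : Finset V} {r1 r2 : V} {m k Kn ℓ : ℕ}
    (hR : Clq G R) (h1 : r1 ∈ R) (h2 : r2 ∈ R) (hne : r1 ≠ r2) (hp : PV G Q r1 r2 m)
    (hQR : ∀ x ∈ Q, x ∈ R → x = r1 ∨ x = r2) (hk : al G Q ≤ k) (hm : Kn + 2 ≤ m)
    (hRc : ℓ ≤ R.card + Kn) (hℓ : 2 * k + Kn + 2 ≤ ℓ) (h3 : 3 ≤ ℓ) : HasCycleLength G ℓ := by
  obtain ⟨m', hm1, hm2, hp'⟩ : ∃ m', Kn + 2 ≤ m' ∧ m' ≤ ℓ ∧ PV G Q r1 r2 m' := by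
    rcases Nat.le_total m ℓ with h | h
    · exact ⟨m, hm, h, hp⟩
    · obtain ⟨m', a1, a2, a3⟩ := hp.hit (T := ℓ) hk (by omega) h
      exact ⟨m', by omega, a2, a3⟩
  rcases hm2.eq_or_lt with rfl | hlt
  · exact hp'.cycle (hR r2 h2 r1 h1 hne.symm) h3
  · have hsub : R \ {r1, r2} ⊆ R := sdiff_subset
    have hcard : ℓ - m' ≤ (R \ {r1, r2}).card := by
      have := le_card_sdiff {r1, r2} R
      rw [card_pair hne] at this
      omega
    have hdis : Disjoint Q (R \ {r1, r2}) := by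
      rw [Finset.disjoint_left]
      intro x hx hx'
      simp only [mem_sdiff, mem_insert, mem_singleton] at hx'
      exact hx'.2 (hQR x hx hx'.1)
    have key : ∀ u v, u ∈ R \ {r1, r2} → v ∈ R \ {r1, r2} →
        PV G (R \ {r1, r2}) u v (ℓ - m') → HasCycleLength G ℓ := by
      intro u v hu hv hq
      simp only [mem_sdiff, mem_insert, mem_singleton, not_or] at hu hv
      have p := hp'.append hq hdis (hR r2 h2 u hu.1 (Ne.symm hu.2.2))
      rw [Nat.add_sub_cancel' hm2] at p
      exact p.cycle (hR v hv.1 r1 h1 hv.2.1) h3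
    rcases Nat.lt_or_ge (ℓ - m') 2 with h | h
    · obtain ⟨u, hu⟩ := card_pos.1 (show 0 < (R \ {r1, r2}).card by omega)
      refine key u u hu hu ?_
      rw [show ℓ - m' = 1 by omega]
      exact PV.single hu
    · obtain ⟨u, hu, v, hv, huv⟩ := one_lt_card.1 (show 1 < (R \ {r1, r2}).card by omega)
      exact key u v hu hv ((hR.subset hsub).pv _ hu hv huv h hcard)

theorem Cor.long {V : Type} {G : SimpleGraph V} {D : Finset V} {lam K : ℝ} (hc : Cor G D lam K)
    {s : ℕ} (h1 : (al G D : ℝ) + 2 * s + K + 3 ≤ lam) (h2 : 2 * (s:ℝ) + 1 ≤ K / 2) {d1 d2 : V}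
    (hd1 : d1 ∈ D) (hd2 : d2 ∈ D) (hne : d1 ≠ d2) : ∃ m, 2 * s + 2 ≤ m ∧ PV G D d1 d2 m := by
  have hdeg := hc.degN (n := al G D + 2 * s + 2) (by push_cast; linarith)
  obtain ⟨F, q, a1, a2, a3, a4, a5, a6⟩ := flex (Y := {d2}) hdeg hd1 (by simpa using hne) s (by
    simp)
  have h3 := hdeg q (a1 a3)
  have h4 := le_card_sdiff F (nb G D q)
  obtain ⟨z, hz⟩ := card_pos.1 (show 0 < (nb G D q \ F).card by omega)
  rw [mem_sdiff, mem_nb] at hz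
  have hzD : z ∈ D \ F := mem_sdiff.2 ⟨hz.1.1, hz.2⟩
  have hd2F : d2 ∈ D \ F := mem_sdiff.2 ⟨hd2, by simpa using a4⟩
  have hF : (F.card : ℝ) ≤ K / 2 := by
    have : (F.card : ℝ) ≤ 2 * s + 1 := by exact_mod_cast a5
    linarith
  obtain ⟨m, hm⟩ := reach_path hzD (hc.conn hF hzD hd2F)
  have p := (a6 (2 * s + 1) (by omega) le_rfl).append (hm.mono reach_subset) disjoint_sdiff hz.1.2
  refine ⟨_, ?_, p.mono (union_subset a1 sdiff_subset)⟩
  have := hm.one_le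
  omega

theorem regime2 (c δ : ℝ) (hδ : 0 < δ) (hδ2 : δ ≤ 1 / 20) (hcδ : 2 + 20 * δ ≤ c) :
    ∃ k0 : ℕ, ∀ k : ℕ, k0 ≤ k → ∀ (V : Type) [Fintype V] (G : SimpleGraph V) (ℓ : ℕ),
      al G univ ≤ k → c * (k:ℝ) ^ 2 ≤ Fintype.card V → (c - δ) * k ≤ ℓ → (ℓ:ℝ) ≤ c * k →
      HasCycleLength G ℓ := by
  obtain ⟨k1, hk1⟩ := core_thm c δ (by linarith) hδ (by linarith)
  obtain ⟨k2, hk2⟩ := exists_nat_ge (20 / δ)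
  refine ⟨max k1 k2, ?_⟩
  intro k hk V _ G ℓ hal hcard hℓ1 hℓ2
  have hkr : 20 ≤ δ * k := by
    have h1 : (k2:ℝ) ≤ k := by exact_mod_cast (le_max_right _ _).trans hk
    have h2 := hk2.trans h1
    rw [div_le_iff₀ hδ] at h2
    linarith
  have hkpos : (0:ℝ) < k := by
    by_contra h
    push Not at h
    have := mul_nonneg hδ.le (neg_nonneg.2 h)
    linarith
  have hδk2 : δ * k ≤ k / 20 := by
    have := mul_le_mul_of_nonneg_right hδ2 hkpos.le
    linarith
  have hck : (2 + 20 * δ) * k ≤ c * k := mul_le_mul_of_nonneg_right hcδ hkpos.le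
  have hℓk : 2 * (k:ℝ) + 19 * (δ * k) ≤ ℓ := by linarith
  have hℓpos : (0:ℝ) < ℓ := by linarith
  have hℓ3 : 3 ≤ ℓ := by
    have : (3:ℝ) ≤ ℓ := by linarith
    exact_mod_cast this
  have halr : (al G (univ : Finset V) : ℝ) ≤ k := by exact_mod_cast hal
  have hne : (univ : Finset V).Nonempty := by
    rw [← card_pos, card_univ]
    have : (0:ℝ) < Fintype.card V := lt_of_lt_of_le (by nlinarith) hcard
    exact_mod_cast this
  obtain ⟨U, -, hUne, hUbig, hUmin⟩ := exists_min_f G (fun a => (ℓ:ℝ) * a) hne (by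
    rw [card_univ]
    have := mul_le_mul hℓ2 halr (Nat.cast_nonneg _) (by nlinarith)
    show (ℓ:ℝ) * (al G univ : ℝ) ≤ _
    nlinarith)
  have hUbigN : ℓ * al G U ≤ U.card := by exact_mod_cast hUbig
  have hUminN : ∀ A, A ⊂ U → A.Nonempty → A.card < ℓ * al G A := by
    intro A hA hA'
    have := hUmin A hA hA'
    exact_mod_cast this
  have hUk : al G U ≤ k := (al_mono (subset_univ _)).trans hal
  have hUkr : (al G U : ℝ) ≤ k := by exact_mod_cast hUk
  have hcut : ∀ v, ∀ x ∈ U \ {v}, ∀ y ∈ U \ {v}, y ∈ Reach G (U \ {v}) x := by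
    intro v x hx y hy
    by_contra hn
    set A := Reach G (U \ {v}) x with hA
    have hyB : y ∈ (U \ {v}) \ A := mem_sdiff.2 ⟨hy, hn⟩
    have hxA : x ∈ A := self_mem_reach hx
    have hsA : A ⊆ U := reach_subset.trans sdiff_subset
    have hsB : (U \ {v}) \ A ⊆ U := sdiff_subset.trans sdiff_subset
    have c1 := hUminN A ⟨hsA, fun h => hn (h (hsB hyB))⟩ ⟨x, hxA⟩
    have c2 := hUminN ((U \ {v}) \ A) ⟨hsB, fun h => (mem_sdiff.1 (h (hsA hxA))).2 hxA⟩ ⟨y, hyB⟩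
    have c3 : al G A + al G ((U \ {v}) \ A) ≤ al G U :=
      (al_union_ge reach_sep).trans (al_mono (union_subset hsA hsB))
    have c4 : U.card ≤ A.card + ((U \ {v}) \ A).card + 1 := by
      have a1 : U ⊆ (A ∪ ((U \ {v}) \ A)) ∪ {v} := by
        intro z hz
        simp only [mem_union, mem_sdiff, mem_singleton]
        tauto
      have a2 := card_le_card a1
      have a3 := card_union_le (A ∪ ((U \ {v}) \ A)) {v}
      have a4 := card_union_le A ((U \ {v}) \ A)
      rw [card_singleton] at a3
      omega
    have c5 := Nat.mul_le_mul_left ℓ c3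
    rw [Nat.mul_add] at c5
    omega
  have hU1 := one_le_al (G := G) hUne
  rcases hU1.eq_or_lt with h1 | h1
  · rw [← h1] at hUbigN
    exact (clq_of_al h1.symm.le).cycle hℓ3 (by omega)
  have hcore := hk1 k ((le_max_left _ _).trans hk) V G U ℓ ℓ (by linarith) hℓ2 (by linarith) le_rfl
    hUne hUk (by
      have : 0 ≤ δ * k * √(al G U : ℝ) := by positivity
      linarith)
  rcases hcore with h | ⟨R, hRU, hR, hRc⟩
  · exact h
  by_cases hRℓ : ℓ ≤ R.card
  · exact hR.cycle hℓ3 hRℓ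
  have hsd : U.card ≤ (U \ R).card + R.card := by
    have := le_card_sdiff R U
    omega
  have hsdr : (U.card : ℝ) ≤ (U \ R).card + R.card := by exact_mod_cast hsd
  have hRr : (R.card : ℝ) ≤ ℓ := by exact_mod_cast (not_le.1 hRℓ).le
  have hal2 : (2:ℝ) ≤ al G U := by exact_mod_cast h1
  have hbig : (ℓ:ℝ) / 2 * al G U ≤ (U \ R).card := by
    have := mul_le_mul_of_nonneg_left hal2 hℓpos.le
    linarith
  have hal3 : (al G (U \ R) : ℝ) ≤ al G U := by exact_mod_cast al_mono sdiff_subset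
  obtain ⟨D, hDU, hcD⟩ := exists_cor (G := G) (U := U \ R) (lam := (ℓ:ℝ) / 2) (K := 5 * (δ * k))
    (by
      rw [← card_pos]
      have : (0:ℝ) < (U \ R).card := lt_of_lt_of_le (by positivity) hbig
      exact_mod_cast this)
    (by
      have a1 : 0 ≤ 5 * (δ * k) * √(al G (U \ R) : ℝ) := by positivity
      have a2 := mul_le_mul_of_nonneg_left hal3 (show (0:ℝ) ≤ (ℓ:ℝ) / 2 by linarith)
      linarith) (by linarith) (by linarith)
  set Kn := ⌈δ * k⌉₊ with hKn
  have hKn1 : δ * k ≤ Kn := Nat.le_ceil _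
  have hKn2 : (Kn:ℝ) < δ * k + 1 := Nat.ceil_lt_add_one (by linarith)
  have halD : (al G D : ℝ) ≤ k := by
    have : (al G D : ℝ) ≤ al G (U \ R) := by exact_mod_cast al_mono hDU
    linarith
  have hD2 : 2 ≤ D.card := by
    have := hcD.card_ge
    have a1 : (1:ℝ) ≤ al G D := by exact_mod_cast one_le_al hcD.ne
    have a2 : (ℓ:ℝ) / 2 - 5 * (δ * k) ≤ ((ℓ:ℝ) / 2 - 5 * (δ * k)) * al G D :=
      le_mul_of_one_le_right (by linarith) a1
    have : (2:ℝ) ≤ D.card := by linarith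
    exact_mod_cast this
  have hR2 : 2 ≤ R.card := by
    have : (2:ℝ) ≤ R.card := by linarith
    exact_mod_cast this
  obtain ⟨Q, r1, r2, m, hQ, hr1, hr2, hr12, hm, hp, hQR⟩ := long_link (G := G) (N := 2 * Kn + 2)
    (hDU.trans sdiff_subset) hRU (disjoint_of_subset_left hDU sdiff_disjoint) hD2 hR2 hcut
    (fun d1 hd1 d2 hd2 hne => hcD.long (s := Kn) (by linarith) (by linarith) hd1 hd2 hne)
  refine finish (k := k) (Kn := Kn) hR hr1 hr2 hr12 hp hQR ((al_mono hQ).trans hUk) (by omega) ?_ ?_ hℓ3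
  · have : (ℓ:ℝ) ≤ R.card + Kn := by linarith
    exact_mod_cast this
  · have : 2 * (k:ℝ) + Kn + 2 ≤ ℓ := by linarith
    exact_mod_cast this

end CycP

theorem stmt11 (ε : ℝ) (hε : 0 < ε) :
    ∃ k₀ : ℕ, ∀ k : ℕ, k₀ ≤ k →
      ∀ (V : Type) [Fintype V] (G : SimpleGraph V), IndepNumLE G k →
        (2 + ε) * (k : ℝ) ^ 2 ≤ (Fintype.card V : ℝ) →
        ∀ ℓ : ℕ, 3 ≤ ℓ → (ℓ : ℝ) ≤ (2 + ε) * (k : ℝ) → HasCycleLength G ℓ := by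
  classical
  obtain ⟨δ, hδ, hδ1, hδ2⟩ : ∃ δ : ℝ, 0 < δ ∧ δ ≤ 1 / 20 ∧ 20 * δ ≤ ε :=
    ⟨min (1 / 20) (ε / 20), lt_min (by norm_num) (by linarith), min_le_left _ _, by
      have := min_le_right (1 / 20 : ℝ) (ε / 20)
      linarith⟩
  obtain ⟨k1, hk1⟩ := CycP.core_thm (2 + ε) δ (by linarith) hδ (by linarith)
  obtain ⟨k2, hk2⟩ := CycP.regime2 (2 + ε) δ hδ hδ1 (by linarith)
  obtain ⟨k3, hk3⟩ := exists_nat_ge (20 / δ)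
  refine ⟨max k1 (max k2 k3), ?_⟩
  intro k hk V _ G hI hcard ℓ hℓ3 hℓ
  have e1 : k1 ≤ k := (le_max_left _ _).trans hk
  have e2 : k2 ≤ k := (le_max_left _ _).trans ((le_max_right _ _).trans hk)
  have e3 : k3 ≤ k := (le_max_right _ _).trans ((le_max_right _ _).trans hk)
  have hal : CycP.al G (univ : Finset V) ≤ k := by
    obtain ⟨I, -, h2, h3⟩ := CycP.exists_ind G (univ : Finset V)
    rw [← h3]
    exact hI I h2
  have hkr : 20 ≤ δ * k := by
    have h1 : (k3:ℝ) ≤ k := by exact_mod_cast e3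
    have h2 := hk3.trans h1
    rw [div_le_iff₀ hδ] at h2
    linarith
  have hkpos : (0:ℝ) < k := by
    by_contra h
    push Not at h
    have := mul_nonneg hδ.le (neg_nonneg.2 h)
    linarith
  have hεk : 20 * δ * k ≤ ε * k := mul_le_mul_of_nonneg_right hδ2 hkpos.le
  have hδk2 : δ * k ≤ k / 20 := by
    have := mul_le_mul_of_nonneg_right hδ1 hkpos.le
    linarith
  have hne : (univ : Finset V).Nonempty := by
    rw [← card_pos, card_univ]
    have : (0:ℝ) < Fintype.card V := lt_of_lt_of_le (by positivity) hcard
    exact_mod_cast this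
  have halr : (CycP.al G (univ : Finset V) : ℝ) ≤ k := by exact_mod_cast hal
  have hmul : (2 + ε) * k * CycP.al G (univ : Finset V) ≤ (univ : Finset V).card := by
    rw [card_univ]
    have := mul_le_mul_of_nonneg_left halr (show 0 ≤ (2 + ε) * (k:ℝ) by positivity)
    nlinarith
  by_cases h1 : 2 * (ℓ - 2) ≤ k
  · refine CycP.small_regime (U := univ) (D := 2 * (k:ℝ) + 2) hal hne (by linarith) ?_ hℓ3 h1
    refine le_trans (mul_le_mul_of_nonneg_right ?_ (Nat.cast_nonneg _)) hmul
    linarith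
  · have hℓk : (k:ℝ) / 2 ≤ ℓ := by
      have : (k:ℝ) ≤ 2 * ℓ := by exact_mod_cast (show k ≤ 2 * ℓ by omega)
      linarith
    by_cases h2 : (ℓ:ℝ) ≤ (2 + ε - δ) * k
    · rcases hk1 k e1 V G univ ((2 + ε) * k) ℓ (by linarith) le_rfl hℓk hℓ hne hal (by
        have : 0 ≤ δ * k * √(CycP.al G (univ : Finset V) : ℝ) := by positivity
        linarith) with h | ⟨R, -, hR, hRc⟩
      · exact h
      · refine hR.cycle hℓ3 ?_
        have : (ℓ:ℝ) ≤ R.card := by linarith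
        exact_mod_cast this
    · exact hk2 k e2 V G ℓ hal hcard (not_le.1 h2).le hℓ
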